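/- arXiv:1207.6503 — 4 statements merged into one kernel-verified Lean document; each statement's English description precedes it below -/
import Mathlib

section
/- Let K be an algebraically closed field and A = K⟨x,y⟩ the free algebra on x, y. Let f_1, …, f_ξ ∈ A be homogeneous of positive degree, let I be the two-sided ideal they generate, let r_i be the number of indices j with 2^i < deg f_j ≤ 2^{i+1}, let Y = { i ≥ 1 : r_i ≠ 0 }, and assume every deg f_j satisfies 2^n + 2^{n-1} ≤ deg f_j ≤ 2^n + 2^{n-1} + 2^{n-2} for some integer n ≥ 2. Assume that for each n ∈ Y there is a natural number e(n) with 1 ≤ e(n) ≤ n−1 such that the sets S_n = {n−e(n)−1, n−e(n), …, n−1} (n ∈ Y) are pairwise disjoint and such that for all n ∈ Y one has r_n · 2^{3n+4} · ∏_{k∈Y, k<n} 2^{2^{e(k)+2}} ≤ 2^{2^{e(n)−1}}. Then: (a) there exist two monomials m_1, m_2 ∈ A of the same degree whose images in A/I generate a free subalgebra; (b) there exists a homogeneous two-sided ideal J of A with I ⊆ J such that A/J is infinite-dimensional over K, prime, left and right Noetherian, and has linear growth. -/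
/-
Formalization of statements from:
"Golod-Shafarevich algebras of a reduced number of defining relations" (A. Smoktunowicz).

`FA K` is the free associative unital `K`-algebra `A = K⟨x,y⟩` on two generators
(`FreeAlgebra.ι K 0` and `FreeAlgebra.ι K 1`), graded with the generators in degree 1.
-/

open scoped Pointwise Classical

noncomputable section

/-- The free associative unital `K`-algebra on two generators. -/
abbrev FA (K : Type) [Field K] : Type := FreeAlgebra K (Fin 2)

variable (K : Type) [Field K]

/-- The set of monomials of degree `k` in the free algebra on two generators. -/
def Mon (k : ℕ) : Set (FA K) :=
  { m | ∃ w : List (Fin 2), w.length = k ∧ m = (w.map (FreeAlgebra.ι K)).prod }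

/-- `Adeg K k` is the `k`-th homogeneous component `A(k)`: the span of the monomials of
degree `k`. -/
def Adeg (k : ℕ) : Submodule K (FA K) :=
  Submodule.span K (Mon K k)

/-- Properties (1)-(4) of the families `U(2^m)`, `V(2^m)` of subspaces of `A(2^m)`
(Section 1 of the paper):
(1) `V(2^m)` is spanned by monomials (of degree `2^m`);
(2) `V(2^m) + U(2^m) = A(2^m)` and `V(2^m) ∩ U(2^m) = 0`;
(3) `A(2^{m-1})U(2^{m-1}) + U(2^{m-1})A(2^{m-1}) ⊆ U(2^m)`;
(4) `V(2^m) ⊆ V(2^{m-1})V(2^{m-1})`;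
with `V(2^0) = Kx + Ky` and `U(2^0) = 0`. -/
def UVCond (U V : ℕ → Submodule K (FA K)) : Prop :=
  V 0 = Submodule.span K {FreeAlgebra.ι K 0, FreeAlgebra.ι K 1} ∧
  U 0 = ⊥ ∧
  ∀ m : ℕ, 1 ≤ m →
    (∃ s ⊆ Mon K (2 ^ m), V m = Submodule.span K s) ∧
    U m ≤ Adeg K (2 ^ m) ∧
    V m ⊔ U m = Adeg K (2 ^ m) ∧
    V m ⊓ U m = ⊥ ∧
    Adeg K (2 ^ (m - 1)) * U (m - 1) ⊔ U (m - 1) * Adeg K (2 ^ (m - 1)) ≤ U m ∧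
    V m ≤ V (m - 1) * V (m - 1)

/-- The homogeneous component `E(k)` (as a set), for `k ≥ 1`.  For the unique `n` with
`2^(n-1) ≤ k < 2^n` (i.e. `n = Nat.log 2 k + 1`) it consists of those `r ∈ A(k)` with
`A r A ∩ A(2^(n+1)) ⊆ U(2^n)A(2^n) + A(2^n)U(2^n)`; here `A r A` is the two-sided ideal
generated by `r`, realized as the subspace `⊤ * span{r} * ⊤`. -/
def ESet (U : ℕ → Submodule K (FA K)) (k : ℕ) : Set (FA K) :=
  { r | r ∈ Adeg K k ∧
    (⊤ : Submodule K (FA K)) * Submodule.span K {r} * ⊤ ⊓ Adeg K (2 ^ (Nat.log 2 k + 2)) ≤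
      U (Nat.log 2 k + 1) * Adeg K (2 ^ (Nat.log 2 k + 1)) ⊔
        Adeg K (2 ^ (Nat.log 2 k + 1)) * U (Nat.log 2 k + 1) }

/-- The graded subspace `E = ⊕_{k ≥ 1} E(k)` (each `E(k)` is a subspace, so the span of the
union of the `E(k)` is their direct sum). -/
def Esub (U : ℕ → Submodule K (FA K)) : Submodule K (FA K) :=
  Submodule.span K (⋃ k ∈ Set.Ici 1, ESet K U k)

/-- Auxiliary: the product of the `V(2^p)` over the set bits of `k`, lowest bit first,
with bit positions shifted by `i`. -/
def prodLow (V : ℕ → Submodule K (FA K)) (i k : ℕ) : Submodule K (FA K) :=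
  if _h : k = 0 then 1
  else (if k % 2 = 1 then V i else 1) * prodLow V (i + 1) (k / 2)
termination_by k
decreasing_by exact Nat.div_lt_self (Nat.pos_of_ne_zero _h) one_lt_two

/-- Auxiliary: the product of the `V(2^p)` over the set bits of `k`, highest bit first. -/
def prodHigh (V : ℕ → Submodule K (FA K)) (i k : ℕ) : Submodule K (FA K) :=
  if _h : k = 0 then 1
  else prodHigh V (i + 1) (k / 2) * (if k % 2 = 1 then V i else 1)
termination_by k
decreasing_by exact Nat.div_lt_self (Nat.pos_of_ne_zero _h) one_lt_two

/-- `V^<(k) = V(2^{p_1}) ⋯ V(2^{p_t})` where `k = 2^{p_1} + ⋯ + 2^{p_t}` in binary with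
`p_1 < ⋯ < p_t`; `V^<(0) = K·1`. -/
def Vlt (V : ℕ → Submodule K (FA K)) (k : ℕ) : Submodule K (FA K) := prodLow K V 0 k

/-- `V^>(k) = V(2^{p_t}) ⋯ V(2^{p_1})`; `V^>(0) = K·1`. -/
def Vgt (V : ℕ → Submodule K (FA K)) (k : ℕ) : Submodule K (FA K) := prodHigh K V 0 k

/-- `U^<(k) = Σ_i A(2^{p_1}+⋯+2^{p_{i-1}}) U(2^{p_i}) A(2^{p_{i+1}}+⋯+2^{p_t})`
(for each set bit `p_i` of `k`, the lower part of `k` is `k % 2^{p_i}` and the upper part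
is `k - k % 2^{p_i} - 2^{p_i}`); `U^<(0) = 0`. -/
def Ult (U : ℕ → Submodule K (FA K)) (k : ℕ) : Submodule K (FA K) :=
  ⨆ (p : ℕ) (_ : k.testBit p),
    Adeg K (k % 2 ^ p) * U p * Adeg K (k - k % 2 ^ p - 2 ^ p)

/-- `U^>(k) = Σ_i A(2^{p_t}+⋯+2^{p_{i+1}}) U(2^{p_i}) A(2^{p_{i-1}}+⋯+2^{p_1})`;
`U^>(0) = 0`. -/
def Ugt (U : ℕ → Submodule K (FA K)) (k : ℕ) : Submodule K (FA K) :=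
  ⨆ (p : ℕ) (_ : k.testBit p),
    Adeg K (k - k % 2 ^ p - 2 ^ p) * U p * Adeg K (k % 2 ^ p)

/-- The Capelli polynomial
`d_n(x_1,…,x_n; y_1,…,y_n) = Σ_{σ ∈ Sym(n)} sgn(σ) x_{σ(1)} y_1 x_{σ(2)} y_2 ⋯ x_{σ(n)} y_n`,
evaluated in a ring. -/
def capelli {R : Type*} [Ring R] (n : ℕ) (x y : Fin n → R) : R :=
  ∑ σ : Equiv.Perm (Fin n),
    (Equiv.Perm.sign σ : ℤ) • ((List.finRange n).map fun i => x (σ i) * y i).prod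

/-- The quotient map `R → R ⧸ c` (for a ring congruence `c`) as a `K`-linear map. -/
def mkLin {R : Type*} [Semiring R] [Algebra K R] (c : RingCon R) :
    R →ₗ[K] c.Quotient where
  toFun := RingCon.toQuotient
  map_add' _ _ := rfl
  map_smul' _ _ := rfl

/-- A two-sided ideal of the free algebra is homogeneous iff it is spanned by its
homogeneous elements. -/
def IsHomogTSI (J : TwoSidedIdeal (FA K)) : Prop :=
  (J : Set (FA K)) ⊆ ↑(Submodule.span K {a : FA K | a ∈ J ∧ ∃ n, a ∈ Adeg K n})

/-- `S = ⋃_{n ∈ Y} {n - e(n) - 1, …, n - 1}`. -/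
def SetS (Y : Set ℕ) (e : ℕ → ℕ) : Set ℕ :=
  ⋃ n ∈ Y, Set.Icc (n - e n - 1) (n - 1)

/-- Conditions (1)-(8) of Theorem 4.1 of the paper, at index `m`, for the families
`F(2^m)`, `U(2^m)`, `V(2^m)` of subspaces of `A(2^m)`:
(1) `dim V(2^m) = 2` if `m ∉ S` and (in case `Y` is finite) `m ≤ max Y`;
(2) `dim V(2^{k-e(k)-1+j}) = 2^{2^j}` for all `k ∈ Y` and `0 ≤ j ≤ e(k)`;
(3) `V(2^m)` is spanned by monomials;
(4) `F(2^m) ⊆ U(2^m)` for `m ∈ Y`, and `F(2^m) = 0` for `m ∉ Y`;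
(5) `V(2^m) ⊕ U(2^m) = A(2^m)`;
(6) `A(2^{m-1})U(2^{m-1}) + U(2^{m-1})A(2^{m-1}) ⊆ U(2^m)`;
(7) `V(2^m) ⊆ V(2^{m-1})V(2^{m-1})`;
(8) if `Y` is finite and `m > max Y`, then `dim V(2^m) = 1`. -/
def Conds (Y : Set ℕ) (e : ℕ → ℕ) (F U V : ℕ → Submodule K (FA K)) (m : ℕ) : Prop :=
  (m ∉ SetS Y e → (Y.Finite → ∃ k ∈ Y, m ≤ k) → Module.finrank K (V m) = 2) ∧
  (∀ k ∈ Y, ∀ j ≤ e k, k - e k - 1 + j = m → Module.finrank K (V m) = 2 ^ 2 ^ j) ∧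
  (∃ s ⊆ Mon K (2 ^ m), V m = Submodule.span K s) ∧
  (m ∈ Y → F m ≤ U m) ∧ (m ∉ Y → F m = ⊥) ∧
  U m ≤ Adeg K (2 ^ m) ∧
  V m ⊔ U m = Adeg K (2 ^ m) ∧ V m ⊓ U m = ⊥ ∧
  (Adeg K (2 ^ (m - 1)) * U (m - 1) ⊔ U (m - 1) * Adeg K (2 ^ (m - 1)) ≤ U m) ∧
  V m ≤ V (m - 1) * V (m - 1) ∧
  (Y.Finite → (∀ k ∈ Y, k < m) → Module.finrank K (V m) = 1)

section

variable {K}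

/-- The substitution sending the first `i` variables to `0`. -/
def killVars {n : ℕ} (i : ℕ) : MvPolynomial (Fin n) K →ₐ[K] MvPolynomial (Fin n) K :=
  MvPolynomial.aeval fun j => if (j : ℕ) < i then 0 else MvPolynomial.X j

lemma ker_killVars_lt {n i : ℕ} (hi : i < n) :
    RingHom.ker (killVars (K := K) (n := n) i) <
      RingHom.ker (killVars (K := K) (n := n) (i + 1)) := by
  have hcomp : (killVars (K := K) (n := n) (i + 1)).comp (killVars i) = killVars (i + 1) := by
    ext j : 1
    simp only [killVars, AlgHom.comp_apply, MvPolynomial.aeval_X]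
    split_ifs with h1 h2 h2
    · simp
    · omega
    · simp only [MvPolynomial.aeval_X, if_pos h2]
    · simp only [MvPolynomial.aeval_X, if_neg h2]
  refine lt_of_le_of_ne (fun p hp => ?_) (fun h => ?_)
  · rw [RingHom.mem_ker] at hp ⊢
    rw [← hcomp, AlgHom.comp_apply, hp, map_zero]
  · have h1 : (MvPolynomial.X ⟨i, hi⟩ : MvPolynomial (Fin n) K) ∈
        RingHom.ker (killVars (K := K) (n := n) i) := by
      rw [h, RingHom.mem_ker]
      simp [killVars]
    rw [RingHom.mem_ker] at h1
    simp [killVars] at h1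

lemma le_height_ker_killVars {n i : ℕ} (hi : i ≤ n) :
    (i : ℕ∞) ≤ (RingHom.ker (killVars (K := K) (n := n) i)).height := by
  induction i with
  | zero => simp
  | succ i ih =>
    have := RingHom.ker_isPrime (killVars (K := K) (n := n) i)
    have := RingHom.ker_isPrime (killVars (K := K) (n := n) (i + 1))
    have h1 := Ideal.height_add_one_le_of_lt_of_isPrime (ker_killVars_lt (K := K) (n := n) hi)
    refine le_trans ?_ h1
    push_cast
    gcongr
    exact ih (by omega)

/-- Over an algebraically closed field, fewer polynomials than variables, all vanishing at the
origin, have a common zero other than the origin. -/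
lemma exists_ne_zero_common_zero [IsAlgClosed K] {n : ℕ} {β : Type} [Fintype β]
    (p : β → MvPolynomial (Fin n) K) (h0 : ∀ b, MvPolynomial.eval 0 (p b) = 0)
    (hc : Fintype.card β < n) :
    ∃ x : Fin n → K, x ≠ 0 ∧ ∀ b, MvPolynomial.eval x (p b) = 0 := by
  by_contra! hcon
  set s : Finset (MvPolynomial (Fin n) K) := Finset.univ.image p with hs
  have hloc : MvPolynomial.zeroLocus K (Ideal.span (s : Set (MvPolynomial (Fin n) K))) = {0} := by
    rw [MvPolynomial.zeroLocus_span]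
    ext x
    simp only [Set.mem_ofPred_eq, Set.mem_singleton_iff]
    constructor
    · intro h
      by_contra hx
      obtain ⟨b, hb⟩ := hcon x hx
      exact hb (by simpa [MvPolynomial.aeval_eq_eval] using h (p b) (by simp [hs]))
    · rintro rfl q hq
      simp only [hs, Finset.coe_image, Finset.coe_univ, Set.image_univ, Set.mem_range] at hq
      obtain ⟨b, rfl⟩ := hq
      simpa [MvPolynomial.aeval_eq_eval] using h0 b
  have hrad := MvPolynomial.vanishingIdeal_zeroLocus_eq_radical (K := K)
    (Ideal.span (s : Set (MvPolynomial (Fin n) K)))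
  rw [hloc] at hrad
  set m : Ideal (MvPolynomial (Fin n) K) := MvPolynomial.vanishingIdeal K {(0 : Fin n → K)} with hm
  have hmem : ∀ q, q ∈ m ↔ MvPolynomial.eval 0 q = 0 := by
    intro q
    rw [hm, MvPolynomial.mem_vanishingIdeal_singleton_iff, MvPolynomial.aeval_eq_eval]
  have hprime : m.IsPrime := by
    rw [hm]; infer_instance
  have hmin : m ∈ (Ideal.span (s : Set (MvPolynomial (Fin n) K))).minimalPrimes := by
    rw [← Ideal.radical_minimalPrimes, ← hrad, Ideal.minimalPrimes_eq_subsingleton_self]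
    rfl
  have hle := Ideal.height_le_card_of_mem_minimalPrimes_span_finset hmin
  have hge := le_height_ker_killVars (K := K) (le_refl n)
  have hker : RingHom.ker (killVars (K := K) (n := n) n) ≤ m := by
    intro q hq
    rw [RingHom.mem_ker] at hq
    rw [hmem]
    have : (MvPolynomial.aeval (0 : Fin n → K)).comp (killVars (K := K) (n := n) n) =
        MvPolynomial.aeval 0 := by
      ext j : 1
      simp [killVars]
    have h2 := DFunLike.congr_fun this q
    rw [AlgHom.comp_apply, hq, map_zero, MvPolynomial.aeval_eq_eval] at h2
    exact h2.symm
  have h1 : (n : ℕ∞) ≤ s.card := hge.trans ((Ideal.height_mono hker).trans hle)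
  have h2 : n ≤ s.card := by exact_mod_cast h1
  have h3 : s.card ≤ Fintype.card β := Finset.card_image_le
  omega

lemma exists_ne_zero_isotropic [IsAlgClosed K] {V : Type} [AddCommGroup V] [Module K V]
    [FiniteDimensional K V] {α β : Type} [Fintype α] [Fintype β]
    (l : α → V →ₗ[K] K) (B : β → V →ₗ[K] V →ₗ[K] K)
    (hc : Fintype.card α + Fintype.card β < Module.finrank K V) :
    ∃ x : V, x ≠ 0 ∧ (∀ a, l a x = 0) ∧ ∀ b, B b x x = 0 := by
  set bs := Module.finBasis K V with hbs
  let p : α ⊕ β → MvPolynomial (Fin (Module.finrank K V)) K := Sum.elim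
    (fun a => ∑ i, MvPolynomial.C (l a (bs i)) * MvPolynomial.X i)
    (fun b => ∑ i, ∑ j, MvPolynomial.C (B b (bs i) (bs j)) *
      (MvPolynomial.X i * MvPolynomial.X j))
  obtain ⟨x, hx, hp⟩ := exists_ne_zero_common_zero p
    (by rintro (a | b) <;> simp [p]) (by simpa using hc)
  refine ⟨∑ i, x i • bs i, fun h => hx ?_, fun a => ?_, fun b => ?_⟩
  · funext i
    exact Fintype.linearIndependent_iff.mp bs.linearIndependent x h i
  · have := hp (Sum.inl a)
    simp only [p, Sum.elim_inl, map_sum, map_mul, MvPolynomial.eval_C, MvPolynomial.eval_X] at this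
    simpa [mul_comm] using this
  · have := hp (Sum.inr b)
    simp only [p, Sum.elim_inr, map_sum, map_mul, MvPolynomial.eval_C, MvPolynomial.eval_X] at this
    rw [← this]
    simp only [map_sum, map_smul, LinearMap.sum_apply, LinearMap.smul_apply, smul_eq_mul,
      Finset.mul_sum]
    rw [Finset.sum_comm]
    exact Finset.sum_congr rfl fun i _ => Finset.sum_congr rfl fun j _ => by ring

/-- Few linear and bilinear equations over an algebraically closed field have a two-dimensional
space of common isotropic solutions, given here by a basis in echelon form. -/
lemma exists_isotropic_pair [IsAlgClosed K] {ι α β : Type} [Fintype ι] [Fintype α] [Fintype β]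
    (l : α → (ι → K) →ₗ[K] K) (B : β → (ι → K) →ₗ[K] (ι → K) →ₗ[K] K)
    (hc : Fintype.card α + 3 * Fintype.card β + 1 < Fintype.card ι) :
    ∃ (c : Fin 2 → ι → K) (p : Fin 2 → ι),
      (∀ i j, c i (p j) = if i = j then 1 else 0) ∧ (∀ a i, l a (c i) = 0) ∧
      ∀ b i j, B b (c i) (c j) = 0 := by
  obtain ⟨x, hx, hlx, hBx⟩ := exists_ne_zero_isotropic l B (by simp; omega)
  obtain ⟨p, hp⟩ := Function.ne_iff.mp hx
  simp only [Pi.zero_apply] at hp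
  obtain ⟨y, hy, hly, hBy⟩ := exists_ne_zero_isotropic (V := ι → K)
    (Sum.elim l (Sum.elim (fun b => B b x) (Sum.elim (fun b => (B b).flip x)
      (fun _ : Unit => LinearMap.proj p)))) B (by simp; omega)
  obtain ⟨q, hq⟩ := Function.ne_iff.mp hy
  simp only [Pi.zero_apply] at hq
  have hyp : y p = 0 := hly (Sum.inr (Sum.inr (Sum.inr ())))
  have h1 : ∀ a, l a y = 0 := fun a => hly (Sum.inl a)
  have h2 : ∀ b, B b x y = 0 := fun b => hly (Sum.inr (Sum.inl b))
  have h3 : ∀ b, B b y x = 0 := fun b => hly (Sum.inr (Sum.inr (Sum.inl b)))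
  refine ⟨![(x p)⁻¹ • (x - (x q * (y q)⁻¹) • y), (y q)⁻¹ • y], ![p, q], ?_, ?_, ?_⟩
  · intro i j
    fin_cases i <;> fin_cases j <;> simp [hyp, hp, hq]
  · intro a i
    fin_cases i <;> simp [hlx, h1]
  · intro b i j
    fin_cases i <;> fin_cases j <;> simp [hBx, hBy, h2, h3]

/-- The functional on words that applies `φ` to the first `L` letters and `ψ` to the rest. -/
def tens (L : ℕ) (φ ψ : List (Fin 2) → K) : List (Fin 2) → K :=
  fun w => φ (w.take L) * ψ (w.drop L)

lemma tens_append {L : ℕ} (φ ψ : List (Fin 2) → K) {u : List (Fin 2)} (hu : u.length = L)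
    (v : List (Fin 2)) : tens L φ ψ (u ++ v) = φ u * ψ v := by
  simp [tens, ← hu]

/-- `tens L` as a bilinear map. -/
def tensₗ (L : ℕ) : (List (Fin 2) → K) →ₗ[K] (List (Fin 2) → K) →ₗ[K] (List (Fin 2) → K) :=
  LinearMap.mk₂ K (tens L)
    (fun _ _ _ => by funext w; simp [tens, add_mul])
    (fun _ _ _ => by funext w; simp [tens, mul_assoc])
    (fun _ _ _ => by funext w; simp [tens, mul_add])
    (fun _ _ _ => by funext w; simp [tens, mul_left_comm])

@[simp] lemma tensₗ_apply (L : ℕ) (φ ψ : List (Fin 2) → K) : tensₗ L φ ψ = tens L φ ψ := rfl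

lemma tens_assoc (L M : ℕ) (φ ψ χ : List (Fin 2) → K) :
    tens (L + M) (tens L φ ψ) χ = tens L φ (tens M ψ χ) := by
  funext w
  simp only [tens, List.take_take, List.drop_drop, List.drop_take, mul_assoc]
  simp

/-- The set of functionals `S` restricts to prefixes of length `a` with rank at most `N`. -/
def PrefixRank (S : Set (List (Fin 2) → K)) (a N : ℕ) : Prop :=
  ∃ (κ : Type) (_ : Fintype κ) (α : κ → List (Fin 2) → K) (y : κ → List (Fin 2)),
    Fintype.card κ ≤ N ∧ (∀ k, (y k).length = a) ∧
    ∀ χ ∈ S, ∀ u : List (Fin 2), u.length = a → ∀ g, χ (u ++ g) = ∑ k, α k u * χ (y k ++ g)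

/-- The set of functionals `S` restricts to suffixes of length `a` with rank at most `N`. -/
def SuffixRank (S : Set (List (Fin 2) → K)) (a N : ℕ) : Prop :=
  ∃ (κ : Type) (_ : Fintype κ) (α : κ → List (Fin 2) → K) (y : κ → List (Fin 2)),
    Fintype.card κ ≤ N ∧ (∀ k, (y k).length = a) ∧
    ∀ χ ∈ S, ∀ u : List (Fin 2), u.length = a → ∀ g, χ (g ++ u) = ∑ k, α k u * χ (g ++ y k)

lemma PrefixRank.mono {S T : Set (List (Fin 2) → K)} {a N : ℕ} (h : PrefixRank S a N)
    (hT : T ⊆ Submodule.span K S) : PrefixRank T a N := by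
  obtain ⟨κ, _, α, y, hc, hy, hS⟩ := h
  refine ⟨κ, _, α, y, hc, hy, fun χ hχ u hu g => ?_⟩
  replace hχ := hT hχ
  induction hχ using Submodule.span_induction with
  | mem χ h => exact hS χ h u hu g
  | zero => simp
  | add χ ψ _ _ h1 h2 => simp [h1, h2, mul_add, Finset.sum_add_distrib]
  | smul c χ _ h1 => simp [h1, Finset.mul_sum, mul_left_comm]

lemma SuffixRank.mono {S T : Set (List (Fin 2) → K)} {a N : ℕ} (h : SuffixRank S a N)
    (hT : T ⊆ Submodule.span K S) : SuffixRank T a N := by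
  obtain ⟨κ, _, α, y, hc, hy, hS⟩ := h
  refine ⟨κ, _, α, y, hc, hy, fun χ hχ u hu g => ?_⟩
  replace hχ := hT hχ
  induction hχ using Submodule.span_induction with
  | mem χ h => exact hS χ h u hu g
  | zero => simp
  | add χ ψ _ _ h1 h2 => simp [h1, h2, mul_add, Finset.sum_add_distrib]
  | smul c χ _ h1 => simp [h1, Finset.mul_sum, mul_left_comm]

variable (K) in
/-- A family of `d` functionals on the words of length `L`, with a dual family of words. -/
structure DualFamily (L d : ℕ) where
  /-- the functionals -/
  fn : Fin d → List (Fin 2) → K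
  /-- the dual words -/
  word : Fin d → List (Fin 2)
  length_word : ∀ i, (word i).length = L
  fn_eq_zero : ∀ i w, w.length ≠ L → fn i w = 0
  dual : ∀ i j, fn i (word j) = if i = j then 1 else 0

namespace DualFamily

variable {L d : ℕ} (Φ : DualFamily K L d)

/-- The pairwise products of the functionals in a dual family. -/
def sq (p : Fin d × Fin d) : List (Fin 2) → K := tens L (Φ.fn p.1) (Φ.fn p.2)

lemma sq_eq_zero (p : Fin d × Fin d) {w : List (Fin 2)} (hw : w.length ≠ 2 * L) :
    Φ.sq p w = 0 := by
  by_cases h : (w.take L).length = L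
  · have h2 : (w.drop L).length ≠ L := by
      simp at h ⊢; omega
    simp [sq, tens, Φ.fn_eq_zero _ _ h2]
  · simp [sq, tens, Φ.fn_eq_zero _ _ h]

lemma sq_dual (p q : Fin d × Fin d) :
    Φ.sq p (Φ.word q.1 ++ Φ.word q.2) = if p = q then 1 else 0 := by
  rw [sq, tens_append _ _ (Φ.length_word _), Φ.dual, Φ.dual]
  by_cases h1 : p.1 = q.1 <;> by_cases h2 : p.2 = q.2 <;> simp [h1, h2, Prod.ext_iff]

lemma prefixRank_sq_of_le {a N : ℕ} (h : PrefixRank (Set.range Φ.fn) a N) (ha : a ≤ L) :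
    PrefixRank (Set.range Φ.sq) a N := by
  obtain ⟨κ, _, α, y, hc, hy, hS⟩ := h
  refine ⟨κ, _, α, y, hc, hy, ?_⟩
  rintro _ ⟨p, rfl⟩ u hu g
  have key : ∀ x : List (Fin 2), x.length = a →
      Φ.sq p (x ++ g) = Φ.fn p.1 (x ++ g.take (L - a)) * Φ.fn p.2 (g.drop (L - a)) := by
    intro x hx
    rw [sq, tens, List.take_append, List.drop_append, List.take_of_length_le (by omega),
      List.drop_eq_nil_of_le (by omega), hx, List.nil_append]
  rw [key u hu, hS _ ⟨p.1, rfl⟩ u hu, Finset.sum_mul]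
  exact Finset.sum_congr rfl fun k _ => by rw [key _ (hy k), mul_assoc]

lemma suffixRank_sq_of_le {a N : ℕ} (h : SuffixRank (Set.range Φ.fn) a N) (ha : a ≤ L) :
    SuffixRank (Set.range Φ.sq) a N := by
  obtain ⟨κ, _, α, y, hc, hy, hS⟩ := h
  refine ⟨κ, _, α, y, hc, hy, ?_⟩
  rintro _ ⟨p, rfl⟩ u hu g
  by_cases hg : g.length = 2 * L - a
  · have key : ∀ x : List (Fin 2), x.length = a →
        Φ.sq p (g ++ x) = Φ.fn p.1 (g.take L) * Φ.fn p.2 (g.drop L ++ x) := by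
      intro x hx
      rw [sq, tens, List.take_append_of_le_length (by omega),
        List.drop_append_of_le_length (by omega)]
    rw [key u hu, hS _ ⟨p.2, rfl⟩ u hu, Finset.mul_sum]
    exact Finset.sum_congr rfl fun k _ => by rw [key _ (hy k)]; ring
  · rw [Φ.sq_eq_zero _ (by simp; omega)]
    exact (Finset.sum_eq_zero fun k _ => by
      rw [Φ.sq_eq_zero _ (by simp [hy k]; omega), mul_zero]).symm

lemma prefixRank_sq_add {a N : ℕ} (h : PrefixRank (Set.range Φ.fn) a N) :
    PrefixRank (Set.range Φ.sq) (L + a) (d * N) := by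
  obtain ⟨κ, _, α, y, hc, hy, hS⟩ := h
  refine ⟨Fin d × κ, inferInstance, fun ik => tens L (Φ.fn ik.1) (α ik.2),
    fun ik => Φ.word ik.1 ++ y ik.2, ?_, ?_, ?_⟩
  · simpa using Nat.mul_le_mul_left d hc
  · intro ik
    simp [Φ.length_word, hy]
  rintro _ ⟨p, rfl⟩ u hu g
  obtain ⟨u1, u2, rfl, hu1⟩ : ∃ u1 u2, u = u1 ++ u2 ∧ u1.length = L :=
    ⟨u.take L, u.drop L, by simp, by simp; omega⟩
  have hu2 : u2.length = a := by simp at hu; omega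
  rw [Fintype.sum_prod_type]
  simp only [sq, List.append_assoc, tens_append _ _ hu1, tens_append _ _ (Φ.length_word _), Φ.dual]
  rw [Finset.sum_eq_single p.1, hS _ ⟨p.2, rfl⟩ u2 hu2, Finset.mul_sum]
  · simp [mul_assoc]
  · intro i _ hi
    simp [hi.symm]
  · simp

lemma suffixRank_sq_add {a N : ℕ} (h : SuffixRank (Set.range Φ.fn) a N) (ha : a ≤ L) :
    SuffixRank (Set.range Φ.sq) (L + a) (d * N) := by
  obtain ⟨κ, _, α, y, hc, hy, hS⟩ := h
  refine ⟨Fin d × κ, inferInstance, fun ik => tens a (α ik.2) (Φ.fn ik.1),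
    fun ik => y ik.2 ++ Φ.word ik.1, ?_, ?_, ?_⟩
  · simpa using Nat.mul_le_mul_left d hc
  · intro ik
    simp [Φ.length_word, hy, add_comm]
  rintro _ ⟨p, rfl⟩ u hu g
  obtain ⟨u1, u2, rfl, hu1⟩ : ∃ u1 u2, u = u1 ++ u2 ∧ u1.length = a :=
    ⟨u.take a, u.drop a, by simp, by simp; omega⟩
  have hu2 : u2.length = L := by simp at hu; omega
  by_cases hg : g.length = L - a
  · have key : ∀ x z : List (Fin 2), x.length = a →
        Φ.sq p (g ++ (x ++ z)) = Φ.fn p.1 (g ++ x) * Φ.fn p.2 z := by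
      intro x z hx
      rw [sq, ← List.append_assoc, tens_append _ _ (by simp; omega)]
    rw [Fintype.sum_prod_type]
    simp only [key _ _ hu1, key _ _ (hy _), tens_append _ _ hu1, Φ.dual]
    rw [Finset.sum_eq_single p.2, hS _ ⟨p.1, rfl⟩ u1 hu1, Finset.sum_mul]
    · exact Finset.sum_congr rfl fun k _ => by simp; ring
    · intro i _ hi
      simp [hi.symm]
    · simp
  · rw [Φ.sq_eq_zero _ (by simp; omega)]
    exact (Finset.sum_eq_zero fun k _ => by
      rw [Φ.sq_eq_zero _ (by simp [hy, Φ.length_word]; omega), mul_zero]).symm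

end DualFamily

/-- Evaluation of the functional `χ` on `∑ c(w) u w v`. -/
def pairing (c : List (Fin 2) →₀ K) (u v : List (Fin 2)) : (List (Fin 2) → K) →ₗ[K] K :=
  ∑ w ∈ c.support, c w • LinearMap.proj (u ++ (w ++ v))

lemma pairing_apply (c : List (Fin 2) →₀ K) (u v : List (Fin 2)) (χ : List (Fin 2) → K) :
    pairing c u v χ = ∑ w ∈ c.support, c w * χ (u ++ (w ++ v)) := by
  simp [pairing, LinearMap.sum_apply]

/-- Products of two or three functionals from `S` vanish on all multiples of the relation `c`, of
degree `δ`, that straddle two or three blocks of length `L`. -/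
structure Kills (L : ℕ) (S : Set (List (Fin 2) → K)) (c : List (Fin 2) →₀ K) (δ : ℕ) : Prop where
  two : ∀ φ ∈ S, ∀ ψ ∈ S, ∀ u v : List (Fin 2), u.length + δ + v.length = 2 * L →
    pairing c u v (tens L φ ψ) = 0
  three : ∀ φ ∈ S, ∀ ψ ∈ S, ∀ χ ∈ S, ∀ u v : List (Fin 2), u.length < L → v.length < L →
    u.length + δ + v.length = 3 * L → pairing c u v (tens L φ (tens L ψ χ)) = 0

lemma exists_fin_family {κ V : Type} [Fintype κ] [Zero V] (l : κ → V) {Q : ℕ}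
    (hQ : Fintype.card κ ≤ Q) : ∃ l' : Fin Q → V, ∀ k, ∃ q, l' q = l k := by
  obtain ⟨e⟩ : Nonempty (κ ↪ Fin Q) := Function.Embedding.nonempty_of_card_le (by simpa using hQ)
  exact ⟨Function.extend e l 0, fun k => ⟨e k, e.injective.extend_apply _ _ _⟩⟩

lemma exists_bilinear_of_rank {S : Set (List (Fin 2) → K)} {V : Type} [AddCommGroup V] [Module K V]
    (T : V →ₗ[K] (List (Fin 2) → K)) (hT : ∀ x, T x ∈ Submodule.span K S)
    {M a b Na Nb Q : ℕ} (ha : PrefixRank S a Na) (hb : SuffixRank S b Nb) (hQ : Na * Nb ≤ Q)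
    {c : List (Fin 2) →₀ K} {δ : ℕ} (hc : ∀ w, c w ≠ 0 → w.length = δ)
    (hab : a + δ + b = 2 * M) (haM : a ≤ M) (hbM : b ≤ M) :
    ∃ B : Fin Q → V →ₗ[K] V →ₗ[K] K, ∀ x y, (∀ q, B q x y = 0) →
      ∀ u v : List (Fin 2), u.length = a → v.length = b →
        pairing c u v (tens M (T x) (T y)) = 0 := by
  replace ha := ha.mono (T := Set.range T) (by rintro _ ⟨x, rfl⟩; exact hT x)
  replace hb := hb.mono (T := Set.range T) (by rintro _ ⟨x, rfl⟩; exact hT x)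
  obtain ⟨κ, _, α, y, hκ, hy, hS⟩ := ha
  obtain ⟨μ, _, β, z, hμ, hz, hS'⟩ := hb
  obtain ⟨B, hB⟩ := exists_fin_family (Q := Q) (fun p : κ × μ =>
    ((tensₗ M).compl₁₂ T T).compr₂ (pairing c (y p.1) (z p.2)))
    (by rw [Fintype.card_prod]; exact (Nat.mul_le_mul hκ hμ).trans hQ)
  refine ⟨B, fun x x' h u v hu hv => ?_⟩
  have hB' : ∀ k m, pairing c (y k) (z m) (tens M (T x) (T x')) = 0 := by
    intro k m
    obtain ⟨q, hq⟩ := hB (k, m)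
    have := h q
    rw [hq] at this
    simpa using this
  have key : ∀ w ∈ c.support, ∀ u v : List (Fin 2), u.length = a → v.length = b →
      tens M (T x) (T x') (u ++ (w ++ v)) =
        T x (u ++ w.take (M - a)) * T x' (w.drop (M - a) ++ v) := by
    intro w hw u v hu hv
    have hwl := hc w (Finsupp.mem_support_iff.mp hw)
    have : u ++ (w ++ v) = (u ++ w.take (M - a)) ++ (w.drop (M - a) ++ v) := by
      rw [List.append_assoc, ← List.append_assoc (w.take _), List.take_append_drop]
    rw [this, tens_append _ _ (by simp; omega)]
  have : pairing c u v (tens M (T x) (T x')) =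
      ∑ k, ∑ m, α k u * β m v * pairing c (y k) (z m) (tens M (T x) (T x')) := by
    simp only [pairing_apply, Finset.mul_sum]
    rw [Finset.sum_congr rfl fun k _ => Finset.sum_comm, Finset.sum_comm]
    refine Finset.sum_congr rfl fun w hw => ?_
    rw [key w hw u v hu hv, hS _ ⟨x, rfl⟩ u hu, hS' _ ⟨x', rfl⟩ v hv, Finset.sum_mul_sum,
      Finset.mul_sum]
    refine Finset.sum_congr rfl fun k _ => ?_
    rw [Finset.mul_sum]
    refine Finset.sum_congr rfl fun m _ => ?_
    rw [key w hw _ _ (hy k) (hz m)]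
    ring
  rw [this]
  exact Finset.sum_eq_zero fun k _ => Finset.sum_eq_zero fun m _ => by rw [hB', mul_zero]

lemma exists_linear_of_rank {S : Set (List (Fin 2) → K)} {V : Type} [AddCommGroup V] [Module K V]
    (T : V →ₗ[K] (List (Fin 2) → K)) (hT : ∀ x, T x ∈ Submodule.span K S)
    {M a b Na Nb Q : ℕ} (ha : SuffixRank S a Na) (hb : PrefixRank S b Nb) (hQ : Na * Nb ≤ Q)
    {c : List (Fin 2) →₀ K} {δ : ℕ} (hc : ∀ w, c w ≠ 0 → w.length = δ)
    (hab : a + M + b = δ) :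
    ∃ B : Fin Q → V →ₗ[K] K, ∀ x, (∀ q, B q x = 0) → ∀ x₁ x₂,
      ∀ u v : List (Fin 2), u.length + a = M → v.length + b = M →
        pairing c u v (tens M (T x₁) (tens M (T x) (T x₂))) = 0 := by
  replace ha := ha.mono (T := Set.range T) (by rintro _ ⟨x, rfl⟩; exact hT x)
  replace hb := hb.mono (T := Set.range T) (by rintro _ ⟨x, rfl⟩; exact hT x)
  obtain ⟨κ, _, α, y, hκ, hy, hS⟩ := ha
  obtain ⟨μ, _, β, z, hμ, hz, hS'⟩ := hb
  obtain ⟨B, hB⟩ := exists_fin_family (Q := Q) (fun p : κ × μ =>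
    (∑ w ∈ c.support, (c w * α p.1 (w.take a) * β p.2 (w.drop (a + M))) •
      LinearMap.proj ((w.drop a).take M) : (List (Fin 2) → K) →ₗ[K] K) ∘ₗ T)
    (by rw [Fintype.card_prod]; exact (Nat.mul_le_mul hκ hμ).trans hQ)
  refine ⟨B, fun x h x₁ x₂ u v hu hv => ?_⟩
  have hB' : ∀ k m, ∑ w ∈ c.support, c w * α k (w.take a) * β m (w.drop (a + M)) *
      T x ((w.drop a).take M) = 0 := by
    intro k m
    obtain ⟨q, hq⟩ := hB (k, m)
    have := h q
    rw [hq] at this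
    simpa [LinearMap.sum_apply] using this
  have key : ∀ w ∈ c.support, tens M (T x₁) (tens M (T x) (T x₂)) (u ++ (w ++ v)) =
      T x₁ (u ++ w.take a) * (T x ((w.drop a).take M) * T x₂ (w.drop (a + M) ++ v)) := by
    intro w hw
    have hwl := hc w (Finsupp.mem_support_iff.mp hw)
    have : u ++ (w ++ v) =
        (u ++ w.take a) ++ ((w.drop a).take M ++ (w.drop (a + M) ++ v)) := by
      rw [List.append_assoc, ← List.append_assoc (List.take M _), ← List.drop_drop,
        List.take_append_drop, ← List.append_assoc (w.take a), List.take_append_drop]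
    rw [this, tens_append _ _ (by simp; omega), tens_append _ _ (by simp; omega)]
  have : pairing c u v (tens M (T x₁) (tens M (T x) (T x₂))) =
      ∑ k, ∑ m, T x₁ (u ++ y k) * T x₂ (z m ++ v) *
        ∑ w ∈ c.support, c w * α k (w.take a) * β m (w.drop (a + M)) *
          T x ((w.drop a).take M) := by
    simp only [pairing_apply, Finset.mul_sum]
    rw [Finset.sum_congr rfl fun k _ => Finset.sum_comm, Finset.sum_comm]
    refine Finset.sum_congr rfl fun w hw => ?_
    have hwl := hc w (Finsupp.mem_support_iff.mp hw)
    rw [key w hw, hS _ ⟨x₁, rfl⟩ (w.take a) (by simp; omega),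
      hS' _ ⟨x₂, rfl⟩ (w.drop (a + M)) (by simp; omega), Finset.sum_mul, Finset.mul_sum]
    refine Finset.sum_congr rfl fun k _ => ?_
    rw [Finset.mul_sum, Finset.mul_sum, Finset.mul_sum]
    exact Finset.sum_congr rfl fun m _ => by ring
  rw [this]
  exact Finset.sum_eq_zero fun k _ => Finset.sum_eq_zero fun m _ => by rw [hB', mul_zero]

namespace DualFamily

variable {L d : ℕ} (Φ : DualFamily K L d)

/-- If the relations are few enough, two combinations of products of functionals of `Φ` can be
chosen that kill them all. -/
lemma exists_pair [IsAlgClosed K] (hL : 0 < L) {ρ : Type} [Fintype ρ]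
    (c : ρ → List (Fin 2) →₀ K) (δ : ρ → ℕ) (hc : ∀ j w, c j w ≠ 0 → w.length = δ j)
    (hδ : ∀ j, 3 * L ≤ δ j) (hδ' : ∀ j, 2 * δ j ≤ 7 * L) (P : ℕ → ℕ)
    (hpre : ∀ a < 2 * L, PrefixRank (Set.range Φ.sq) a (P a))
    (hsuf : ∀ a < 2 * L, SuffixRank (Set.range Φ.sq) a (P a)) (Q₂ Q₃ : ℕ)
    (h₂ : ∀ j a b, a + δ j + b = 4 * L → P a * P b ≤ Q₂)
    (h₃ : ∀ j a b, a + 2 * L + b = δ j → P a * P b ≤ Q₃)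
    (hcard : Fintype.card ρ * (2 * L) * Q₃ + 3 * (Fintype.card ρ * (2 * L) * Q₂) + 1 < d * d) :
    ∃ Φ' : DualFamily K (2 * L) 2, (∀ i, Φ'.fn i ∈ Submodule.span K (Set.range Φ.sq)) ∧
      ∀ j, Kills (2 * L) (Set.range Φ'.fn) (c j) (δ j) := by
  set T : (Fin d × Fin d → K) →ₗ[K] (List (Fin 2) → K) :=
    Fintype.linearCombination K Φ.sq with hTdef
  have hTa : ∀ x, T x = ∑ p, x p • Φ.sq p := fun x => Fintype.linearCombination_apply K Φ.sq x
  have hT : ∀ x, T x ∈ Submodule.span K (Set.range Φ.sq) := fun x => by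
    rw [hTa]
    exact Submodule.sum_mem _ fun p _ =>
      Submodule.smul_mem _ _ (Submodule.subset_span (Set.mem_range_self _))
  have hB : ∀ ja : ρ × Fin (2 * L), ∃ B : Fin Q₂ → (Fin d × Fin d → K) →ₗ[K]
      (Fin d × Fin d → K) →ₗ[K] K, ∀ x y, (∀ q, B q x y = 0) →
      ∀ u v : List (Fin 2), u.length = ja.2 → u.length + δ ja.1 + v.length = 4 * L →
        pairing (c ja.1) u v (tens (2 * L) (T x) (T y)) = 0 := by
    rintro ⟨j, a⟩
    have h1 := hδ j
    by_cases hja : a + δ j ≤ 4 * L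
    · obtain ⟨B, hB⟩ := exists_bilinear_of_rank T hT (M := 2 * L) (hpre a a.2)
        (hsuf (4 * L - (a + δ j)) (by omega)) (h₂ j a (4 * L - (a + δ j)) (by omega)) (hc j)
        (by omega) (by omega) (by omega)
      exact ⟨B, fun x y h u v hu hv => hB x y h u v hu (by simp only at hu hv; omega)⟩
    · exact ⟨0, fun x y h u v hu hv => by simp only at hu hv; omega⟩
  have hl : ∀ ja : ρ × Fin (2 * L), ∃ B : Fin Q₃ → (Fin d × Fin d → K) →ₗ[K] K,
      ∀ x, (∀ q, B q x = 0) → ∀ x₁ x₂, ∀ u v : List (Fin 2), u.length + ja.2 = 2 * L →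
        v.length < 2 * L → u.length + δ ja.1 + v.length = 6 * L →
        pairing (c ja.1) u v (tens (2 * L) (T x₁) (tens (2 * L) (T x) (T x₂))) = 0 := by
    rintro ⟨j, a⟩
    have h1 := hδ j
    have h2 := hδ' j
    by_cases hja : a + 2 * L ≤ δ j
    · obtain ⟨B, hB⟩ := exists_linear_of_rank T hT (M := 2 * L) (hsuf a a.2)
        (hpre (δ j - (a + 2 * L)) (by omega)) (h₃ j a (δ j - (a + 2 * L)) (by omega)) (hc j)
        (by omega)
      exact ⟨B, fun x h x₁ x₂ u v hu hv huv =>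
        hB x h x₁ x₂ u v hu (by simp only at hu huv; omega)⟩
    · exact ⟨0, fun x h x₁ x₂ u v hu hv huv => by simp only at hu hv huv; omega⟩
  choose B hB using hB
  choose l hl using hl
  obtain ⟨x, p, hxp, hlx, hBx⟩ := exists_isotropic_pair
    (fun q : (ρ × Fin (2 * L)) × Fin Q₃ => l q.1 q.2)
    (fun q : (ρ × Fin (2 * L)) × Fin Q₂ => B q.1 q.2) (by simpa using hcard)
  have hsupp : ∀ y (w : List (Fin 2)), w.length ≠ 2 * L → T y w = 0 := by
    intro y w hw
    rw [hTa, Finset.sum_apply]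
    exact Finset.sum_eq_zero fun q _ => by simp [Φ.sq_eq_zero q hw]
  refine ⟨⟨fun i => T (x i), fun i => Φ.word (p i).1 ++ Φ.word (p i).2, ?_, ?_, ?_⟩, ?_, ?_⟩
  · intro i
    simp [Φ.length_word, two_mul]
  · exact fun i w hw => hsupp _ _ hw
  · intro i j
    simp [hTa, Finset.sum_apply, Φ.sq_dual, hxp]
  · exact fun i => hT _
  · intro j
    have h1 := hδ j
    have h2 := hδ' j
    constructor
    · rintro _ ⟨i₁, rfl⟩ _ ⟨i₂, rfl⟩ u v huv
      exact hB (j, ⟨u.length, by omega⟩) (x i₁) (x i₂)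
        (fun q => hBx ((j, ⟨u.length, by omega⟩), q) i₁ i₂) u v rfl (by simp only; omega)
    · rintro _ ⟨i₁, rfl⟩ _ ⟨i₂, rfl⟩ _ ⟨i₃, rfl⟩ u v hu hv huv
      exact hl (j, ⟨2 * L - u.length, by omega⟩) (x i₂)
        (fun q => hlx ((j, ⟨2 * L - u.length, by omega⟩), q) i₂) (x i₁) (x i₃) u v
        (by simp only; omega) hv (by simp only; omega)

/-- The dual family of all pairwise products. -/
def square : DualFamily K (2 * L) (d * d) where
  fn i := Φ.sq (finProdFinEquiv.symm i)
  word i := Φ.word (finProdFinEquiv.symm i).1 ++ Φ.word (finProdFinEquiv.symm i).2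
  length_word i := by simp only [List.length_append, Φ.length_word]; omega
  fn_eq_zero i w hw := Φ.sq_eq_zero _ hw
  dual i j := by
    rw [Φ.sq_dual]
    simp only [EmbeddingLike.apply_eq_iff_eq]

lemma range_square : Set.range Φ.square.fn = Set.range Φ.sq :=
  finProdFinEquiv.symm.surjective.range_comp Φ.sq

end DualFamily

/-- The bound on prefix and suffix ranks at level `m` for a sequence of dual families of sizes
`D 0, D 1, …`. -/
def rankBound (D : ℕ → ℕ) : ℕ → ℕ → ℕ
  | 0, _ => 1
  | m + 1, a => if a < 2 ^ m then rankBound D m a else D m * rankBound D m (a - 2 ^ m)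

/-- Prefixes and suffixes of the functionals in `S` have ranks bounded by `P`. -/
def RankLE (S : Set (List (Fin 2) → K)) (L : ℕ) (P : ℕ → ℕ) : Prop :=
  ∀ a < L, PrefixRank S a (P a) ∧ SuffixRank S a (P a)

lemma RankLE.mono {S T : Set (List (Fin 2) → K)} {L : ℕ} {P : ℕ → ℕ} (h : RankLE S L P)
    (hT : T ⊆ Submodule.span K S) : RankLE T L P :=
  fun a ha => ⟨(h a ha).1.mono hT, (h a ha).2.mono hT⟩

lemma DualFamily.rankLE_sq {L d : ℕ} (Φ : DualFamily K L d) {P : ℕ → ℕ}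
    (h : RankLE (Set.range Φ.fn) L P) :
    RankLE (Set.range Φ.sq) (2 * L) fun a => if a < L then P a else d * P (a - L) := by
  intro a ha
  by_cases haL : a < L
  · simp only [haL, if_true]
    exact ⟨Φ.prefixRank_sq_of_le (h a haL).1 haL.le, Φ.suffixRank_sq_of_le (h a haL).2 haL.le⟩
  · obtain ⟨b, rfl⟩ := Nat.exists_eq_add_of_le (not_lt.mp haL)
    have hb := h b (by omega)
    simp only [haL, if_false, Nat.add_sub_cancel_left]
    exact ⟨Φ.prefixRank_sq_add hb.1, Φ.suffixRank_sq_add hb.2 (by omega)⟩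

lemma exists_dualFamily_zero :
    ∃ Φ : DualFamily K (2 ^ 0) 2, RankLE (Set.range Φ.fn) (2 ^ 0) fun _ => 1 := by
  refine ⟨⟨fun i w => if w = [i] then 1 else 0, fun i => [i], by simp, ?_, ?_⟩, ?_⟩
  · intro i w hw
    refine if_neg ?_
    rintro rfl
    simp at hw
  · intro i j
    simp [eq_comm]
  · intro a ha
    obtain rfl : a = 0 := by simpa using ha
    refine ⟨⟨Unit, inferInstance, fun _ _ => 1, fun _ => [], by simp, by simp, ?_⟩,
      ⟨Unit, inferInstance, fun _ _ => 1, fun _ => [], by simp, by simp, ?_⟩⟩ <;>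
    · intro χ _ u hu g
      simp [List.length_eq_zero_iff.mp hu]

/-- The relations whose degree lies in `(2 ^ (m + 1), 2 ^ (m + 2)]`. -/
abbrev RelAt {ρ : Type} (δ : ρ → ℕ) (m : ℕ) : Type :=
  {j : ρ // 2 ^ (m + 1) < δ j ∧ δ j ≤ 2 ^ (m + 2)}

/-- The numerical condition that makes it possible to kill, with two functionals at level `m + 1`,
all relations of degree in `(2 ^ (m + 1), 2 ^ (m + 2)]`. -/
def Choosable {ρ : Type} [Fintype ρ] (δ : ρ → ℕ) (D : ℕ → ℕ) (m : ℕ) : Prop :=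
  ∃ Q₂ Q₃, (∀ (j : RelAt δ m) (a b : ℕ), a + δ j + b = 4 * 2 ^ m →
      rankBound D (m + 1) a * rankBound D (m + 1) b ≤ Q₂) ∧
    (∀ (j : RelAt δ m) (a b : ℕ), a + 2 * 2 ^ m + b = δ j →
      rankBound D (m + 1) a * rankBound D (m + 1) b ≤ Q₃) ∧
    Fintype.card (RelAt δ m) * (2 * 2 ^ m) * Q₃ +
      3 * (Fintype.card (RelAt δ m) * (2 * 2 ^ m) * Q₂) + 1 < D m * D m

lemma exists_dualFamily_succ [IsAlgClosed K] {ρ : Type} [Fintype ρ]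
    (c : ρ → List (Fin 2) →₀ K) (δ : ρ → ℕ) (hc : ∀ j w, c j w ≠ 0 → w.length = δ j)
    (D : ℕ → ℕ) (m : ℕ) (hδ : ∀ j : RelAt δ m, 3 * 2 ^ m ≤ δ j ∧ 2 * δ j ≤ 7 * 2 ^ m)
    (hD : (D (m + 1) = D m * D m ∧ IsEmpty (RelAt δ m)) ∨ D (m + 1) = 2 ∧ Choosable δ D m)
    (Φ : DualFamily K (2 ^ m) (D m)) (hΦ : RankLE (Set.range Φ.fn) (2 ^ m) (rankBound D m))
    {M : ℕ} (hM : M = 2 * 2 ^ m) :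
    ∃ Φ' : DualFamily K (M) (D (m + 1)),
      RankLE (Set.range Φ'.fn) (M) (rankBound D (m + 1)) ∧
      (∀ i, Φ'.fn i ∈ Submodule.span K (Set.range Φ.sq)) ∧
      ∀ j : RelAt δ m, Kills (M) (Set.range Φ'.fn) (c j) (δ j) := by
  have hsq : RankLE (Set.range Φ.sq) (2 * 2 ^ m) (rankBound D (m + 1)) := Φ.rankLE_sq hΦ
  subst hM
  obtain ⟨h, hemp⟩ | ⟨h, Q₂, Q₃, h₂, h₃, hcard⟩ := hD
  · rw [h]
    refine ⟨Φ.square, by rwa [Φ.range_square], fun i => ?_, fun j => hemp.elim j⟩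
    exact Submodule.subset_span (Set.mem_range_self _)
  · rw [h]
    obtain ⟨Φ', h1, h2⟩ := Φ.exists_pair (by positivity) (fun j : RelAt δ m => c j)
      (fun j => δ j) (fun j => hc j) (fun j => (hδ j).1) (fun j => (hδ j).2) (rankBound D (m + 1))
      (fun a ha => (hsq a ha).1) (fun a ha => (hsq a ha).2) Q₂ Q₃ h₂ h₃ hcard
    exact ⟨Φ', hsq.mono (by rintro _ ⟨i, rfl⟩; exact h1 i), h1, h2⟩

/-- There is a sequence of dual families, each spanned by products of the previous one, killing
all the relations. -/
lemma exists_dualFamily_sequence [IsAlgClosed K] {ρ : Type} [Fintype ρ]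
    (c : ρ → List (Fin 2) →₀ K) (δ : ρ → ℕ) (hc : ∀ j w, c j w ≠ 0 → w.length = δ j)
    (D : ℕ → ℕ) (hD0 : D 0 = 2)
    (hδ : ∀ m, ∀ j : RelAt δ m, 3 * 2 ^ m ≤ δ j ∧ 2 * δ j ≤ 7 * 2 ^ m)
    (hD : ∀ m, (D (m + 1) = D m * D m ∧ IsEmpty (RelAt δ m)) ∨
      D (m + 1) = 2 ∧ Choosable δ D m) :
    ∃ Φ : ∀ m, DualFamily K (2 ^ m) (D m),
      (∀ m i, (Φ (m + 1)).fn i ∈ Submodule.span K (Set.range (Φ m).sq)) ∧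
      ∀ m, ∀ j : RelAt δ m, Kills (2 ^ (m + 1)) (Set.range (Φ (m + 1)).fn) (c j) (δ j) := by
  have h0 : ∃ Φ : DualFamily K (2 ^ 0) (D 0),
      RankLE (Set.range Φ.fn) (2 ^ 0) (rankBound D 0) := by
    rw [hD0]
    exact exists_dualFamily_zero
  choose Φ₀ hΦ₀ using h0
  choose next hnext using fun m Φ hΦ =>
    exists_dualFamily_succ c δ hc D m (hδ m) (hD m) Φ hΦ (pow_succ' 2 m)
  let F : ∀ m, {Φ : DualFamily K (2 ^ m) (D m) //
      RankLE (Set.range Φ.fn) (2 ^ m) (rankBound D m)} :=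
    Nat.rec ⟨Φ₀, hΦ₀⟩ fun m Φ => ⟨next m Φ.1 Φ.2, (hnext m Φ.1 Φ.2).1⟩
  exact ⟨fun m => (F m).1, fun m => (hnext m (F m).1 (F m).2).2.1,
    fun m => (hnext m (F m).1 (F m).2).2.2⟩

/-- The sizes of the dual families: starting from `2`, square below the levels of `Y`, as often as
prescribed by `e`. -/
def levelDim (Y : Set ℕ) (e : ℕ → ℕ) : ℕ → ℕ
  | 0 => 2
  | m + 1 => if ∃ n ∈ Y, n - e n ≤ m + 1 ∧ m + 1 ≤ n - 1
    then levelDim Y e m * levelDim Y e m else 2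

section levelDim

variable {Y : Set ℕ} {e : ℕ → ℕ}

lemma levelDim_of_not {m : ℕ} (h : ¬ ∃ n ∈ Y, n - e n ≤ m ∧ m ≤ n - 1) : levelDim Y e m = 2 := by
  cases m with
  | zero => rfl
  | succ m => rw [levelDim, if_neg h]

lemma two_le_levelDim (Y : Set ℕ) (e : ℕ → ℕ) (m : ℕ) : 2 ≤ levelDim Y e m := by
  induction m with
  | zero => simp [levelDim]
  | succ m ih =>
    rw [levelDim]
    split_ifs
    · nlinarith
    · norm_num

variable (Y e) in
/-- The intervals `{n - e n - 1, …, n - 1}`, for `n ∈ Y`, are pairwise disjoint. -/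
structure SparseIntervals : Prop where
  one_le : ∀ n ∈ Y, 1 ≤ e n
  le : ∀ n ∈ Y, e n ≤ n - 1
  disj : ∀ n ∈ Y, ∀ m ∈ Y, n ≠ m →
    Disjoint (Set.Icc (n - e n - 1) (n - 1)) (Set.Icc (m - e m - 1) (m - 1))

namespace SparseIntervals

lemma eq_of_mem (H : SparseIntervals Y e) {n k p : ℕ} (hn : n ∈ Y) (hk : k ∈ Y)
    (h1 : n - e n - 1 ≤ p) (h2 : p ≤ n - 1) (h3 : k - e k - 1 ≤ p) (h4 : p ≤ k - 1) : n = k := by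
  by_contra h
  exact Set.disjoint_left.mp (H.disj n hn k hk h) ⟨h1, h2⟩ ⟨h3, h4⟩

lemma levelDim_add (H : SparseIntervals Y e) {n j : ℕ} (hn : n ∈ Y) (hj : j ≤ e n) :
    levelDim Y e (n - e n - 1 + j) = 2 ^ 2 ^ j := by
  have h1 := H.one_le n hn
  have h2 := H.le n hn
  induction j with
  | zero =>
    rw [levelDim_of_not]
    · simp
    rintro ⟨k, hk, h3, h4⟩
    obtain rfl := H.eq_of_mem (p := n - e n - 1 + 0) hn hk (by omega) (by omega) (by omega) h4
    omega
  | succ j ih =>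
    rw [← add_assoc, levelDim, if_pos ⟨n, hn, by omega, by omega⟩, ih (by omega), pow_succ 2 j,
      pow_mul, sq]

lemma not_interior (H : SparseIntervals Y e) {n : ℕ} (hn : n ∈ Y) :
    ¬ ∃ k ∈ Y, k - e k ≤ n ∧ n ≤ k - 1 := by
  rintro ⟨k, hk, h3, h4⟩
  have h1 := H.one_le n hn
  have h2 := H.le n hn
  obtain rfl := H.eq_of_mem (p := n - 1) hn hk (by omega) (by omega) (by omega) (by omega)
  omega

lemma levelDim_mem (H : SparseIntervals Y e) {n : ℕ} (hn : n ∈ Y) : levelDim Y e n = 2 :=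
  levelDim_of_not (H.not_interior hn)

end SparseIntervals

end levelDim

lemma rankBound_le_prod {D : ℕ → ℕ} (hD : ∀ m, 1 ≤ D m) (m a : ℕ) :
    rankBound D m a ≤ ∏ p ∈ Finset.range m, D p := by
  induction m generalizing a with
  | zero => simp [rankBound]
  | succ m ih =>
    rw [rankBound, Finset.prod_range_succ, mul_comm _ (D m)]
    split_ifs
    · exact (ih a).trans (Nat.le_mul_of_pos_left _ (hD m))
    · exact Nat.mul_le_mul_left _ (ih _)

lemma rankBound_add_le {D : ℕ → ℕ} (hD : ∀ m, 1 ≤ D m) {m N : ℕ}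
    (hDm : ∀ j < N, D (m + j) = 2 ^ 2 ^ j) {j : ℕ} (hj : j ≤ N) (a : ℕ) :
    rankBound D (m + j) a ≤ 2 ^ (a / 2 ^ m) * ∏ p ∈ Finset.range m, D p := by
  induction j generalizing a with
  | zero => exact (rankBound_le_prod hD m a).trans (Nat.le_mul_of_pos_left _ (by positivity))
  | succ j ih =>
    rw [← add_assoc, rankBound]
    split_ifs with h
    · exact ih (by omega) a
    · obtain ⟨b, rfl⟩ := Nat.exists_eq_add_of_le (not_lt.mp h)
      rw [Nat.add_sub_cancel_left, hDm j (by omega), pow_add 2 m j,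
        Nat.mul_add_div (by positivity), pow_add 2 (2 ^ j), mul_assoc]
      exact Nat.mul_le_mul_left _ (ih (by omega) b)

lemma prod_range_two_pow_two_pow_le (n : ℕ) :
    ∏ j ∈ Finset.range n, 2 ^ 2 ^ j ≤ 2 ^ 2 ^ n := by
  rw [Finset.prod_pow_eq_pow_sum]
  refine Nat.pow_le_pow_right (by norm_num) ?_
  induction n with
  | zero => simp
  | succ n ih => rw [Finset.sum_range_succ, pow_succ]; omega

lemma prod_ite_interval_le (M a l : ℕ) :
    (∏ p ∈ Finset.range M, if a ≤ p ∧ p ≤ a + l then 2 ^ 2 ^ (p - a) else 1) ≤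
      2 ^ 2 ^ (l + 1) := by
  refine le_trans ?_ (prod_range_two_pow_two_pow_le (l + 1))
  rw [← Finset.prod_filter]
  calc _ ≤ ∏ p ∈ Finset.Ico a (a + (l + 1)), 2 ^ 2 ^ (p - a) := by
        refine Finset.prod_le_prod_of_subset_of_one_le' ?_ fun _ _ _ => Nat.one_le_two_pow
        intro p hp
        simp at hp ⊢
        omega
    _ = _ := by
        rw [Finset.prod_Ico_eq_prod_range]
        simp

namespace SparseIntervals

variable {Y : Set ℕ} {e : ℕ → ℕ}

lemma prod_levelDim_le (H : SparseIntervals Y e) {n : ℕ} (hn : n ∈ Y) :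
    ∏ p ∈ Finset.range (n - e n - 1), levelDim Y e p ≤
      2 ^ n * ∏ k ∈ Finset.range n, if k ∈ Y then 2 ^ 2 ^ (e k + 1) else 1 := by
  have h1 := H.one_le n hn
  have h2 := H.le n hn
  have key : ∀ p < n - e n - 1, levelDim Y e p ≤ 2 * ∏ k ∈ Finset.range n,
      if k ∈ Y then if k - e k - 1 ≤ p ∧ p ≤ k - e k - 1 + e k then 2 ^ 2 ^ (p - (k - e k - 1))
        else 1 else 1 := by
    intro p hp
    have hone : ∀ k, 1 ≤ if k ∈ Y then if k - e k - 1 ≤ p ∧ p ≤ k - e k - 1 + e k then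
        2 ^ 2 ^ (p - (k - e k - 1)) else 1 else 1 := by
      intro k
      split_ifs <;> simp [Nat.one_le_two_pow]
    by_cases hint : ∃ k ∈ Y, k - e k ≤ p ∧ p ≤ k - 1
    · obtain ⟨k, hk, h3, h4⟩ := hint
      have h5 := H.one_le k hk
      have h6 := H.le k hk
      have hkn : k < n := by
        by_contra hkn
        obtain rfl := H.eq_of_mem (p := n - 1) hn hk (by omega) (by omega) (by omega) (by omega)
        omega
      have hd := H.levelDim_add (j := p - (k - e k - 1)) hk (by omega)
      rw [Nat.add_sub_cancel' (by omega)] at hd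
      have := Finset.single_le_prod' (fun k _ => hone k) (Finset.mem_range.mpr hkn)
      rw [if_pos hk, if_pos ⟨by omega, by omega⟩, ← hd] at this
      omega
    · rw [levelDim_of_not hint]
      have := Finset.one_le_prod' (s := Finset.range n) fun k _ => hone k
      omega
  calc _ ≤ _ := Finset.prod_le_prod' fun p hp => key p (Finset.mem_range.mp hp)
    _ = 2 ^ (n - e n - 1) * ∏ k ∈ Finset.range n, ∏ p ∈ Finset.range (n - e n - 1),
        if k ∈ Y then if k - e k - 1 ≤ p ∧ p ≤ k - e k - 1 + e k then
          2 ^ 2 ^ (p - (k - e k - 1)) else 1 else 1 := by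
        rw [Finset.prod_mul_distrib, Finset.prod_comm, Finset.prod_const, Finset.card_range]
    _ ≤ _ := by
        refine Nat.mul_le_mul (Nat.pow_le_pow_right (by norm_num) (by omega))
          (Finset.prod_le_prod' fun k _ => ?_)
        split_ifs
        · exact prod_ite_interval_le _ _ _
        · simp

lemma choosable (H : SparseIntervals Y e) {ρ : Type} [Fintype ρ] (δ : ρ → ℕ) {m : ℕ}
    (hm : m + 1 ∈ Y)
    (hδ : ∀ j : RelAt δ m, 3 * 2 ^ m ≤ δ j ∧ 2 * δ j ≤ 7 * 2 ^ m)
    (hbound : Fintype.card (RelAt δ m) * 2 ^ (3 * (m + 1) + 4) *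
        (∏ k ∈ Finset.range (m + 1), if k ∈ Y then 2 ^ 2 ^ (e k + 2) else 1) ≤
      2 ^ 2 ^ (e (m + 1) - 1)) : Choosable δ (levelDim Y e) m := by
  have h1 := H.one_le _ hm
  have h2 := H.le _ hm
  obtain ⟨E, hE⟩ : ∃ E, e (m + 1) = E + 1 := ⟨e (m + 1) - 1, by omega⟩
  set s := m - e (m + 1) with hs
  have hms : m + 1 = s + (e (m + 1) + 1) := by omega
  have hms' : m + 1 - e (m + 1) - 1 = s := by omega
  set Λ := ∏ p ∈ Finset.range s, levelDim Y e p with hΛ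
  have hP : ∀ a, rankBound (levelDim Y e) (m + 1) a ≤ 2 ^ (a / 2 ^ s) * Λ := by
    intro a
    have := rankBound_add_le (fun k => one_le_two.trans (two_le_levelDim Y e k))
      (m := s) (N := e (m + 1) + 1)
      (fun j hj => by rw [← hms']; exact H.levelDim_add hm (by omega)) le_rfl a
    rwa [← hms] at this
  have hPP : ∀ a b N, a + b ≤ N * 2 ^ s →
      rankBound (levelDim Y e) (m + 1) a * rankBound (levelDim Y e) (m + 1) b ≤ 2 ^ N * Λ ^ 2 := by
    intro a b N hab
    have h3 : a / 2 ^ s + b / 2 ^ s ≤ N :=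
      Nat.div_add_div_le_add_div.trans (Nat.div_le_of_le_mul (by rwa [mul_comm]))
    calc _ ≤ (2 ^ (a / 2 ^ s) * Λ) * (2 ^ (b / 2 ^ s) * Λ) := Nat.mul_le_mul (hP a) (hP b)
      _ = 2 ^ (a / 2 ^ s + b / 2 ^ s) * Λ ^ 2 := by rw [pow_add]; ring
      _ ≤ _ := Nat.mul_le_mul_right _ (Nat.pow_le_pow_right (by norm_num) h3)
  have hm2 : 2 ^ m = 2 * 2 ^ E * 2 ^ s := by
    rw [← pow_succ', ← pow_add]
    congr 1
    omega
  have hDm : levelDim Y e m = (2 ^ 2 ^ E) ^ 2 := by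
    have := H.levelDim_add hm le_rfl
    rw [show m + 1 - e (m + 1) - 1 + e (m + 1) = m by omega, hE, pow_succ, pow_mul] at this
    exact this
  have hΛ2 : Λ ^ 2 ≤ 2 ^ (2 * (m + 1)) *
      ∏ k ∈ Finset.range (m + 1), if k ∈ Y then 2 ^ 2 ^ (e k + 2) else 1 := by
    have h3 := H.prod_levelDim_le hm
    rw [hms'] at h3
    refine (Nat.pow_le_pow_left h3 2).trans_eq ?_
    rw [mul_pow, ← pow_mul, mul_comm (m + 1), ← Finset.prod_pow]
    congr 1
    refine Finset.prod_congr rfl fun k _ => ?_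
    split_ifs
    · rw [← pow_mul, ← pow_succ]
    · simp
  rw [hE, Nat.add_sub_cancel] at hbound
  obtain ⟨R, hR⟩ : ∃ R, R = Fintype.card (RelAt δ m) := ⟨_, rfl⟩
  rw [← hR] at hbound
  set X := R * 2 ^ (m + 1) * Λ ^ 2 with hX
  set d := 2 ^ 2 ^ E with hd
  have hd2 : 2 ≤ d := by
    rw [hd]
    exact Nat.le_self_pow (by positivity) 2
  have hXd : 16 * X ≤ d := by
    refine le_trans ?_ hbound
    calc 16 * X = R * 2 ^ (m + 1 + 4) * Λ ^ 2 := by rw [hX, pow_add]; ring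
      _ ≤ R * 2 ^ (m + 1 + 4) * _ := Nat.mul_le_mul_left _ hΛ2
      _ = _ := by rw [show 3 * (m + 1) + 4 = m + 1 + 4 + 2 * (m + 1) by ring, pow_add 2 (m + 1 + 4)]
                  ring
  refine ⟨2 ^ (2 * 2 ^ E) * Λ ^ 2, 2 ^ (3 * 2 ^ E) * Λ ^ 2, fun j a b hab => hPP a b _ ?_,
    fun j a b hab => hPP a b _ ?_, ?_⟩
  · have := (hδ j).1
    omega
  · have := (hδ j).2
    have : 2 * (a + b) ≤ 3 * 2 ^ m := by omega
    rw [hm2] at this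
    linarith
  · rw [← hR, hDm, mul_comm 2 (2 ^ E), mul_comm 3 (2 ^ E), pow_mul, pow_mul, ← hd, ← pow_succ']
    have e1 : R * 2 ^ (m + 1) * (d ^ 3 * Λ ^ 2) = X * d ^ 3 := by
      rw [hX]; ring
    have e2 : R * 2 ^ (m + 1) * (d ^ 2 * Λ ^ 2) = X * d ^ 2 := by
      rw [hX]; ring
    rw [e1, e2]
    have h4 := Nat.mul_le_mul_right (d ^ 3) hXd
    have h5 := Nat.mul_le_mul_right (d ^ 2) hXd
    have h6 : 2 * d ^ 3 ≤ d ^ 2 * d ^ 2 := by nlinarith [pow_pos (by omega : 0 < d) 3]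
    have h7 : 2 ^ 3 ≤ d ^ 3 := Nat.pow_le_pow_left hd2 3
    nlinarith

lemma levelDim_succ_cases (H : SparseIntervals Y e) {ρ : Type} [Fintype ρ] (δ : ρ → ℕ)
    (hY : ∀ m, Nonempty (RelAt δ m) → m + 1 ∈ Y) (m : ℕ)
    (hδ : ∀ j : RelAt δ m, 3 * 2 ^ m ≤ δ j ∧ 2 * δ j ≤ 7 * 2 ^ m)
    (hbound : m + 1 ∈ Y → Fintype.card (RelAt δ m) * 2 ^ (3 * (m + 1) + 4) *
        (∏ k ∈ Finset.range (m + 1), if k ∈ Y then 2 ^ 2 ^ (e k + 2) else 1) ≤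
      2 ^ 2 ^ (e (m + 1) - 1)) :
    (levelDim Y e (m + 1) = levelDim Y e m * levelDim Y e m ∧ IsEmpty (RelAt δ m)) ∨
      levelDim Y e (m + 1) = 2 ∧ Choosable δ (levelDim Y e) m := by
  by_cases hm : m + 1 ∈ Y
  · exact Or.inr ⟨H.levelDim_mem hm, H.choosable δ hm hδ (hbound hm)⟩
  have hemp : IsEmpty (RelAt δ m) := not_nonempty_iff.mp fun h => hm (hY m h)
  by_cases hint : ∃ n ∈ Y, n - e n ≤ m + 1 ∧ m + 1 ≤ n - 1
  · exact Or.inl ⟨by rw [levelDim, if_pos hint], hemp⟩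
  · refine Or.inr ⟨levelDim_of_not hint, 0, 0, fun j => hemp.elim j, fun j => hemp.elim j, ?_⟩
    have := two_le_levelDim Y e m
    nlinarith

end SparseIntervals

/-- The span of the `k`-fold products of functionals from `S`, each reading `L` letters. -/
def blk (L : ℕ) (S : Set (List (Fin 2) → K)) : ℕ → Submodule K (List (Fin 2) → K)
  | 0 => Submodule.span K {fun w => if w = [] then 1 else 0}
  | k + 1 => Submodule.map₂ (tensₗ L) (Submodule.span K S) (blk L S k)

section blk

variable {L : ℕ} {S : Set (List (Fin 2) → K)}

lemma tens_mem_blk {k : ℕ} {φ χ : List (Fin 2) → K} (hφ : φ ∈ Submodule.span K S)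
    (hχ : χ ∈ blk L S k) : tens L φ χ ∈ blk L S (k + 1) :=
  Submodule.apply_mem_map₂ (tensₗ L) hφ hχ

lemma blk_succ_le {k : ℕ} {P : Submodule K (List (Fin 2) → K)}
    (h : ∀ φ ∈ S, ∀ χ ∈ blk L S k, tens L φ χ ∈ P) : blk L S (k + 1) ≤ P := by
  refine Submodule.map₂_le.mpr fun φ hφ χ hχ => ?_
  have : Submodule.span K S ≤ P.comap ((tensₗ L).flip χ) :=
    Submodule.span_le.mpr fun φ hφ => h φ hφ χ hχ
  exact this hφ

lemma blk_succ_succ_le {k : ℕ} {P : Submodule K (List (Fin 2) → K)}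
    (h : ∀ φ ∈ S, ∀ ψ ∈ S, ∀ χ ∈ blk L S k, tens L φ (tens L ψ χ) ∈ P) : blk L S (k + 2) ≤ P :=
  blk_succ_le fun φ hφ _ hχ =>
    blk_succ_le (P := P.comap (tensₗ L φ)) (fun ψ hψ χ hχ => h φ hφ ψ hψ χ hχ) hχ

lemma blk_eq_zero (hS : ∀ φ ∈ S, ∀ w, w.length ≠ L → φ w = 0) (k : ℕ) :
    ∀ χ ∈ blk L S k, ∀ w, w.length ≠ k * L → χ w = 0 := by
  induction k with
  | zero =>
    intro χ hχ w hw
    obtain ⟨a, rfl⟩ := Submodule.mem_span_singleton.mp hχ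
    have : w ≠ [] := by
      rintro rfl
      simp at hw
    simp [this]
  | succ k ih =>
    intro χ hχ w hw
    refine blk_succ_le (P := LinearMap.ker (LinearMap.proj w)) (fun φ hφ ψ hψ => ?_) hχ
    rw [LinearMap.mem_ker, LinearMap.proj_apply, tens]
    by_cases h : (w.take L).length = L
    · rw [ih ψ hψ _ (by simp at h ⊢; rw [add_mul] at hw; omega), mul_zero]
    · rw [hS φ hφ _ h, zero_mul]

lemma blk_le_blk_two_mul {S' : Set (List (Fin 2) → K)} {M : ℕ} (hM : M = 2 * L)
    (hS : S' ⊆ Submodule.map₂ (tensₗ L) (Submodule.span K S) (Submodule.span K S)) (k : ℕ) :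
    blk M S' k ≤ blk L S (2 * k) := by
  subst hM
  induction k with
  | zero => exact le_rfl
  | succ k ih =>
    refine blk_succ_le fun φ hφ χ hχ => ?_
    have : Submodule.map₂ (tensₗ L) (Submodule.span K S) (Submodule.span K S) ≤
        (blk L S (2 * (k + 1))).comap ((tensₗ (2 * L)).flip χ) := by
      refine Submodule.map₂_le.mpr fun φ hφ ψ hψ => ?_
      rw [Submodule.mem_comap, LinearMap.flip_apply, tensₗ_apply, tensₗ_apply, two_mul L,
        tens_assoc]
      exact tens_mem_blk hφ (tens_mem_blk hψ (ih hχ))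
    exact this (hS hφ)

lemma pairing_tens {c : List (Fin 2) →₀ K} {δ : ℕ} (hc : ∀ w, c w ≠ 0 → w.length = δ) {M : ℕ}
    {u v₁ : List (Fin 2)} (h : u.length + δ + v₁.length = M) (v₂ : List (Fin 2))
    (φ χ : List (Fin 2) → K) :
    pairing c u (v₁ ++ v₂) (tens M φ χ) = pairing c u v₁ φ * χ v₂ := by
  rw [pairing_apply, pairing_apply, Finset.sum_mul]
  refine Finset.sum_congr rfl fun w hw => ?_
  have := hc w (Finsupp.mem_support_iff.mp hw)
  rw [← List.append_assoc w, ← List.append_assoc u, tens_append _ _ (by simp; omega), mul_assoc]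

lemma Kills.pairing_eq_zero {c : List (Fin 2) →₀ K} {δ : ℕ} (hK : Kills L S c δ) (hL : 0 < L)
    (hS : ∀ φ ∈ S, ∀ w, w.length ≠ L → φ w = 0)
    (hc : ∀ w, c w ≠ 0 → w.length = δ) (h1 : L < δ) (h2 : δ ≤ 2 * L) (k : ℕ) :
    ∀ χ ∈ blk L S k, ∀ u v, pairing c u v χ = 0 := by
  have hlen : ∀ k, ∀ χ ∈ blk L S k, ∀ u v : List (Fin 2), u.length + δ + v.length ≠ k * L →
      pairing c u v χ = 0 := by
    intro k χ hχ u v huv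
    rw [pairing_apply]
    refine Finset.sum_eq_zero fun w hw => ?_
    have := hc w (Finsupp.mem_support_iff.mp hw)
    rw [blk_eq_zero hS k χ hχ _ (by simp; omega), mul_zero]
  induction k with
  | zero => exact fun χ hχ u v => hlen 0 χ hχ u v (by omega)
  | succ k ih =>
    intro χ hχ u v
    by_cases huv : u.length + δ + v.length = (k + 1) * L
    swap
    · exact hlen _ χ hχ u v huv
    by_cases hu : L ≤ u.length
    · refine blk_succ_le (P := LinearMap.ker (pairing c u v)) (fun φ _ ψ hψ => ?_) hχ
      have := ih ψ hψ (u.drop L) v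
      rw [pairing_apply] at this
      rw [LinearMap.mem_ker, pairing_apply]
      have key : ∀ x, tens L φ ψ (u ++ x) = φ (u.take L) * ψ (u.drop L ++ x) := by
        intro x
        rw [tens, List.take_append_of_le_length hu, List.drop_append_of_le_length hu]
      simp only [key, mul_left_comm _ (φ (u.take L)), ← Finset.mul_sum, this, mul_zero]
    push Not at hu
    have hk : 1 ≤ k := by
      by_contra hk
      obtain rfl : k = 0 := by omega
      omega
    obtain ⟨l, rfl⟩ := Nat.exists_eq_add_of_le' hk
    by_cases hu2 : u.length + δ ≤ 2 * L
    · refine blk_succ_succ_le (P := LinearMap.ker (pairing c u v)) (fun φ hφ ψ hψ χ _ => ?_) hχ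
      have hv : (2 * L - (u.length + δ)) ≤ v.length := by
        rw [add_mul, add_mul] at huv
        omega
      rw [LinearMap.mem_ker, ← List.take_append_drop (2 * L - (u.length + δ)) v, ← tens_assoc,
        pairing_tens hc (by simp; omega), hK.two φ hφ ψ hψ _ _ (by simp; omega), zero_mul]
    · have hl : 1 ≤ l := by
        by_contra hl
        obtain rfl : l = 0 := by omega
        omega
      obtain ⟨i, rfl⟩ := Nat.exists_eq_add_of_le' hl
      have hle : blk L S (i + 1 + 1 + 1) ≤ LinearMap.ker (pairing c u v) := by
        refine blk_succ_succ_le fun φ hφ ψ hψ χ' hχ' => ?_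
        refine blk_succ_le (P := (LinearMap.ker (pairing c u v)).comap
          (tensₗ L φ ∘ₗ tensₗ L ψ)) (fun θ hθ χ _ => ?_) hχ'
        have hv : (3 * L - (u.length + δ)) ≤ v.length := by
          rw [add_mul, add_mul, add_mul] at huv
          omega
        rw [Submodule.mem_comap, LinearMap.mem_ker, LinearMap.comp_apply, tensₗ_apply,
          tensₗ_apply, ← List.take_append_drop (3 * L - (u.length + δ)) v, ← tens_assoc L L ψ,
          ← tens_assoc L (L + L), pairing_tens hc (by simp; omega),
          hK.three φ hφ ψ hψ θ hθ _ _ hu (by simp; omega) (by simp; omega), zero_mul]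
      exact hle hχ

end blk

/-- A subfamily of a dual family. -/
def DualFamily.comap {L d d' : ℕ} (Φ : DualFamily K L d) (g : Fin d' ↪ Fin d) :
    DualFamily K L d' where
  fn i := Φ.fn (g i)
  word i := Φ.word (g i)
  length_word i := Φ.length_word _
  fn_eq_zero i := Φ.fn_eq_zero _
  dual i j := by simp only [Φ.dual, EmbeddingLike.apply_eq_iff_eq]

lemma blk_mono {L : ℕ} {S T : Set (List (Fin 2) → K)} (h : S ⊆ T) (k : ℕ) :
    blk L S k ≤ blk L T k := by
  induction k with
  | zero => exact le_rfl
  | succ k ih => exact Submodule.map₂_le_map₂ (Submodule.span_mono h) ih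

/-- There are two functionals all of whose products kill all multiples of the relations. -/
lemma exists_killing_pair [IsAlgClosed K] {ρ : Type} [Fintype ρ]
    (c : ρ → List (Fin 2) →₀ K) (δ : ρ → ℕ) (hc : ∀ j w, c j w ≠ 0 → w.length = δ j)
    (hex : ∀ j, ∃ m, 2 ^ (m + 1) < δ j ∧ δ j ≤ 2 ^ (m + 2))
    (D : ℕ → ℕ) (hD0 : D 0 = 2) (hD2 : ∀ m, 2 ≤ D m)
    (hδ : ∀ m, ∀ j : RelAt δ m, 3 * 2 ^ m ≤ δ j ∧ 2 * δ j ≤ 7 * 2 ^ m)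
    (hD : ∀ m, (D (m + 1) = D m * D m ∧ IsEmpty (RelAt δ m)) ∨
      D (m + 1) = 2 ∧ Choosable δ D m) :
    ∃ N, 1 ≤ N ∧ ∃ Φ : DualFamily K N 2,
      ∀ j k, ∀ χ ∈ blk N (Set.range Φ.fn) k, ∀ u v, pairing (c j) u v χ = 0 := by
  obtain ⟨Φ, hΦ, hK⟩ := exists_dualFamily_sequence c δ hc D hD0 hδ hD
  have hle : ∀ n i k, blk (2 ^ (n + i)) (Set.range (Φ (n + i)).fn) k ≤
      blk (2 ^ n) (Set.range (Φ n).fn) (2 ^ i * k) := by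
    intro n i
    induction i with
    | zero => simp
    | succ i ih =>
      intro k
      rw [pow_succ, mul_assoc]
      refine le_trans ?_ (ih _)
      refine blk_le_blk_two_mul (pow_succ' 2 (n + i)) ?_ k
      rintro _ ⟨q, rfl⟩
      refine Submodule.span_le.mpr ?_ (hΦ (n + i) q)
      rintro _ ⟨p, rfl⟩
      exact Submodule.apply_mem_map₂ _ (Submodule.subset_span ⟨p.1, rfl⟩)
        (Submodule.subset_span ⟨p.2, rfl⟩)
  refine ⟨2 ^ ∑ j, δ j, Nat.one_le_two_pow,
    (Φ (∑ j, δ j)).comap (Fin.castLEEmb (hD2 _)), fun j k χ hχ u v => ?_⟩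
  obtain ⟨m, hm, hm'⟩ := hex j
  have hmδ : m + 1 ≤ ∑ j, δ j :=
    (Nat.lt_two_pow_self.trans hm).le.trans
      (Finset.single_le_sum (fun _ _ => Nat.zero_le _) (Finset.mem_univ j))
  obtain ⟨i, hi⟩ := Nat.exists_eq_add_of_le hmδ
  have hχ' : χ ∈ blk (2 ^ (m + 1)) (Set.range (Φ (m + 1)).fn) (2 ^ i * k) := by
    refine hle (m + 1) i k ?_
    rw [← hi]
    refine blk_mono ?_ k hχ
    rintro _ ⟨q, rfl⟩
    exact ⟨_, rfl⟩
  refine (hK m ⟨j, hm, hm'⟩).pairing_eq_zero (by positivity) ?_ (hc j) hm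
    (by rwa [← pow_succ']) _ χ hχ' u v
  rintro _ ⟨q, rfl⟩
  exact (Φ (m + 1)).fn_eq_zero q

/-- The combined form of the construction, in terms of the hypotheses on the relations. -/
lemma exists_killing_pair_of_sparse [IsAlgClosed K] {ρ : Type} [Fintype ρ]
    (c : ρ → List (Fin 2) →₀ K) (δ : ρ → ℕ) (hc : ∀ j w, c j w ≠ 0 → w.length = δ j)
    (hδ : ∀ j, ∃ m, 3 * 2 ^ m ≤ δ j ∧ 2 * δ j ≤ 7 * 2 ^ m)
    {Y : Set ℕ} {e : ℕ → ℕ} (H : SparseIntervals Y e)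
    (hY : ∀ m, Nonempty (RelAt δ m) → m + 1 ∈ Y)
    (hbound : ∀ m, m + 1 ∈ Y → Fintype.card (RelAt δ m) * 2 ^ (3 * (m + 1) + 4) *
        (∏ k ∈ Finset.range (m + 1), if k ∈ Y then 2 ^ 2 ^ (e k + 2) else 1) ≤
      2 ^ 2 ^ (e (m + 1) - 1)) :
    ∃ N, 1 ≤ N ∧ ∃ Φ : DualFamily K N 2,
      ∀ j k, ∀ χ ∈ blk N (Set.range Φ.fn) k, ∀ u v, pairing (c j) u v χ = 0 := by
  have hδ' : ∀ m, ∀ j : RelAt δ m, 3 * 2 ^ m ≤ δ j ∧ 2 * δ j ≤ 7 * 2 ^ m := by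
    rintro m ⟨j, h1, h2⟩
    obtain ⟨m', h3, h4⟩ := hδ j
    have h5 : m < m' + 1 := by
      by_contra! h
      have := Nat.pow_le_pow_right (n := 2) (by norm_num) h
      simp only [pow_succ] at *
      omega
    have h6 : m' < m + 1 := by
      by_contra! h
      have := Nat.pow_le_pow_right (n := 2) (by norm_num) h
      simp only [pow_succ] at *
      omega
    obtain rfl : m = m' := by omega
    exact ⟨h3, h4⟩
  refine exists_killing_pair c δ hc (fun j => ?_) (levelDim Y e) rfl (two_le_levelDim Y e) hδ'
    fun m => H.levelDim_succ_cases δ hY m (hδ' m) (hbound m)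
  obtain ⟨m, h1, h2⟩ := hδ j
  have := Nat.one_le_two_pow (n := m)
  exact ⟨m, by simp only [pow_succ]; omega, by simp only [pow_succ]; omega⟩

/-- The monomial corresponding to a word. -/
def wd (w : List (Fin 2)) : FA K := (w.map (FreeAlgebra.ι K)).prod

@[simp] lemma wd_nil : wd ([] : List (Fin 2)) = (1 : FA K) := rfl

lemma wd_append (u v : List (Fin 2)) : wd (u ++ v) = wd u * (wd v : FA K) := by
  simp [wd]

variable (K) in
/-- The basis of monomials of the free algebra. -/
def wordBasis : Module.Basis (List (Fin 2)) K (FA K) :=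
  (FreeAlgebra.basisFreeMonoid K (Fin 2)).reindex FreeMonoid.toList

lemma wordBasis_apply (w : List (Fin 2)) : wordBasis K w = wd w := by
  rw [wordBasis, Module.Basis.reindex_apply, FreeAlgebra.basisFreeMonoid, Module.Basis.map_apply]
  change MonoidAlgebra.lift K _ _ _ (MonoidAlgebra.single (FreeMonoid.ofList w) 1) = _
  rw [MonoidAlgebra.lift_single, one_smul, FreeMonoid.lift_apply]
  rfl

lemma linearMap_ext_wd {M : Type*} [AddCommGroup M] [Module K M] {f g : FA K →ₗ[K] M}
    (h : ∀ w, f (wd w) = g (wd w)) : f = g :=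
  (wordBasis K).ext fun w => by rw [wordBasis_apply, h]

/-- The linear form on the free algebra with given values on monomials. -/
def ev (χ : List (Fin 2) → K) : FA K →ₗ[K] K := (wordBasis K).constr K χ

@[simp] lemma ev_wd (χ : List (Fin 2) → K) (w : List (Fin 2)) : ev χ (wd w) = χ w := by
  rw [ev, ← wordBasis_apply, Module.Basis.constr_basis]

/-- The homogeneous component of degree `n`. -/
def comp (n : ℕ) : FA K →ₗ[K] FA K :=
  (wordBasis K).constr K fun w => if w.length = n then wd w else 0

lemma comp_wd (n : ℕ) (w : List (Fin 2)) :
    comp n (wd w : FA K) = if w.length = n then wd w else 0 := by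
  have h := (wordBasis K).constr_basis K (fun w => if w.length = n then (wd w : FA K) else 0) w
  rwa [wordBasis_apply] at h

/-- The restriction of a functional to the words of length `n`. -/
def trunc (n : ℕ) (χ : List (Fin 2) → K) : List (Fin 2) → K :=
  fun w => if w.length = n then χ w else 0

lemma ev_comp (n : ℕ) (χ : List (Fin 2) → K) (p : FA K) : ev χ (comp n p) = ev (trunc n χ) p := by
  have : ev χ ∘ₗ comp n = ev (trunc n χ) := linearMap_ext_wd fun w => by
    rw [LinearMap.comp_apply, comp_wd, ev_wd, trunc]
    split_ifs <;> simp
  exact LinearMap.congr_fun this p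

lemma wd_mem_Adeg (w : List (Fin 2)) : (wd w : FA K) ∈ Adeg K w.length :=
  Submodule.subset_span ⟨w, rfl, rfl⟩

lemma Adeg_le {n : ℕ} {P : Submodule K (FA K)} (h : ∀ w : List (Fin 2), w.length = n → wd w ∈ P) :
    Adeg K n ≤ P :=
  Submodule.span_le.mpr (by rintro _ ⟨w, hw, rfl⟩; exact h w hw)

lemma Adeg_mul {m n : ℕ} {p q : FA K} (hp : p ∈ Adeg K m) (hq : q ∈ Adeg K n) :
    p * q ∈ Adeg K (m + n) := by
  refine Adeg_le (P := (Adeg K (m + n)).comap (LinearMap.mulRight K q)) (fun u hu => ?_) hp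
  refine Adeg_le (P := (Adeg K (m + n)).comap (LinearMap.mulLeft K (wd u))) (fun v hv => ?_) hq
  rw [Submodule.mem_comap, LinearMap.mulLeft_apply, ← wd_append, ← hu, ← hv, ← List.length_append]
  exact wd_mem_Adeg _

lemma comp_mem_Adeg (n : ℕ) (p : FA K) : comp n p ∈ Adeg K n := by
  have : (⊤ : Submodule K (FA K)) ≤ (Adeg K n).comap (comp n) := by
    rw [← (wordBasis K).span_eq, Submodule.span_le]
    rintro _ ⟨w, rfl⟩
    rw [wordBasis_apply, SetLike.mem_coe, Submodule.mem_comap, comp_wd]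
    split_ifs with h
    · exact h ▸ wd_mem_Adeg w
    · exact zero_mem _
  exact this Submodule.mem_top

lemma comp_of_mem {n : ℕ} {p : FA K} (hp : p ∈ Adeg K n) (m : ℕ) :
    comp m p = if n = m then p else 0 := by
  have : Adeg K n ≤ LinearMap.eqLocus (comp m) (if n = m then LinearMap.id else 0) :=
    Adeg_le fun w hw => by
      rw [LinearMap.mem_eqLocus, comp_wd, hw]
      split_ifs <;> rfl
  rw [this hp]
  split_ifs <;> rfl

lemma exists_sum_comp (p : FA K) : ∃ s : Finset ℕ, ∑ n ∈ s, comp n p = p := by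
  refine ⟨((wordBasis K).repr p).support.image List.length, ?_⟩
  conv_rhs => rw [← (wordBasis K).linearCombination_repr p]
  simp only [comp, Module.Basis.constr_apply, Finsupp.linearCombination_apply, Finsupp.sum]
  rw [Finset.sum_comm]
  refine Finset.sum_congr rfl fun w hw => ?_
  rw [← Finset.smul_sum, Finset.sum_ite_eq, if_pos (Finset.mem_image_of_mem _ hw), wordBasis_apply]

lemma length_eq_of_repr_ne_zero {n : ℕ} {p : FA K} (hp : p ∈ Adeg K n) (w : List (Fin 2))
    (hw : (wordBasis K).repr p w ≠ 0) : w.length = n := by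
  by_contra h
  refine hw ?_
  have : Adeg K n ≤ LinearMap.ker ((wordBasis K).coord w) := Adeg_le fun u hu => by
    rw [LinearMap.mem_ker, ← wordBasis_apply, Module.Basis.coord_apply, Module.Basis.repr_self,
      Finsupp.single_apply, if_neg]
    rintro rfl
    exact h hu
  exact this hp

lemma ev_mul_mul_eq_pairing (χ : List (Fin 2) → K) (u v : List (Fin 2)) (p : FA K) :
    ev χ (wd u * p * wd v) = pairing ((wordBasis K).repr p) u v χ := by
  rw [pairing_apply]
  conv_lhs => rw [← (wordBasis K).linearCombination_repr p, Finsupp.linearCombination_apply]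
  rw [Finsupp.sum, Finset.mul_sum, Finset.sum_mul, map_sum]
  refine Finset.sum_congr rfl fun w _ => ?_
  rw [wordBasis_apply, mul_smul_comm, smul_mul_assoc, map_smul, mul_assoc, ← wd_append,
    ← wd_append, ev_wd, smul_eq_mul]

/-- The two-sided ideal of all elements whose multiples are annihilated by all functionals
in `X`. -/
def annIdeal (X : Set (List (Fin 2) → K)) : TwoSidedIdeal (FA K) :=
  TwoSidedIdeal.mk' {p | ∀ χ ∈ X, ∀ a b, ev χ (a * p * b) = 0}
    (by simp)
    (fun hx hy χ hχ a b => by rw [mul_add, add_mul, map_add, hx χ hχ, hy χ hχ, add_zero])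
    (fun hx χ hχ a b => by rw [mul_neg, neg_mul, map_neg, hx χ hχ, neg_zero])
    (fun {x y} hy χ hχ a b => by rw [← mul_assoc a]; exact hy χ hχ _ b)
    (fun {x y} hx χ hχ a b => by rw [← mul_assoc a, mul_assoc _ y]; exact hx χ hχ a _)

lemma mem_annIdeal {X : Set (List (Fin 2) → K)} {p : FA K} :
    p ∈ annIdeal X ↔ ∀ χ ∈ X, ∀ a b, ev χ (a * p * b) = 0 :=
  TwoSidedIdeal.mem_mk' _ _ _ _ _ _ _

lemma mem_annIdeal_iff_wd {X : Set (List (Fin 2) → K)} {p : FA K} :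
    p ∈ annIdeal X ↔ ∀ χ ∈ X, ∀ u v, ev χ (wd u * p * wd v) = 0 := by
  rw [mem_annIdeal]
  refine ⟨fun h χ hχ u v => h χ hχ _ _, fun h χ hχ a b => ?_⟩
  have h1 : ∀ u, ev χ ∘ₗ LinearMap.mulLeft K (wd u * p) = 0 := fun u =>
    linearMap_ext_wd fun v => h χ hχ u v
  have h2 : ev χ ∘ₗ LinearMap.mulRight K b ∘ₗ LinearMap.mulRight K p = 0 :=
    linearMap_ext_wd fun u => LinearMap.congr_fun (h1 u) b
  exact LinearMap.congr_fun h2 a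

lemma span_le_annIdeal {ι : Type} {f : ι → FA K} {X : Set (List (Fin 2) → K)}
    (h : ∀ j, ∀ χ ∈ X, ∀ u v, pairing ((wordBasis K).repr (f j)) u v χ = 0) :
    TwoSidedIdeal.span (Set.range f) ≤ annIdeal X := by
  rw [TwoSidedIdeal.span_le]
  rintro _ ⟨j, rfl⟩
  refine mem_annIdeal_iff_wd.mpr fun χ hχ u v => ?_
  rw [ev_mul_mul_eq_pairing, h j χ hχ]

section lift

variable {N : ℕ} (Φ : DualFamily K N 2)

/-- The product functional attached to a word, taking value `1` at its substitution. -/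
def dualWord : List (Fin 2) → List (Fin 2) → K
  | [] => fun w => if w = [] then 1 else 0
  | i :: z => tens N (Φ.fn i) (dualWord z)

lemma dualWord_mem_blk (z : List (Fin 2)) :
    dualWord Φ z ∈ blk N (Set.range Φ.fn) z.length := by
  induction z with
  | nil => exact Submodule.subset_span rfl
  | cons i z ih => exact tens_mem_blk (Submodule.subset_span ⟨i, rfl⟩) ih

lemma dualWord_flatMap (hN : 1 ≤ N) (z y : List (Fin 2)) :
    dualWord Φ z (y.flatMap Φ.word) = if y = z then 1 else 0 := by
  induction z generalizing y with
  | nil =>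
    cases y with
    | nil => simp [dualWord]
    | cons j y =>
      have h : Φ.word j ≠ [] := fun h => by
        have := Φ.length_word j
        rw [h, List.length_nil] at this
        omega
      simp [dualWord, h]
  | cons i z ih =>
    cases y with
    | nil =>
      have : Φ.fn i [] = 0 := Φ.fn_eq_zero i [] (by simp; omega)
      simp [dualWord, tens, this]
    | cons j y =>
      rw [dualWord, List.flatMap_cons, tens_append _ _ (Φ.length_word j), ih, Φ.dual]
      simp only [List.cons.injEq, eq_comm (a := i)]
      split_ifs <;> simp_all

lemma lift_wd (m : Fin 2 → List (Fin 2)) (z : List (Fin 2)) :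
    FreeAlgebra.lift K (fun i => (wd (m i) : FA K)) (wd z) = wd (z.flatMap m) := by
  induction z with
  | nil => simp
  | cons i z ih =>
    rw [List.flatMap_cons, wd_append, ← ih, wd, List.map_cons, List.prod_cons, map_mul,
      FreeAlgebra.lift_ι_apply]
    rfl

lemma ev_dualWord_lift (hN : 1 ≤ N) (z : List (Fin 2)) (p : FA K) :
    ev (dualWord Φ z) (FreeAlgebra.lift K (fun i => (wd (Φ.word i) : FA K)) p) =
      (wordBasis K).repr p z := by
  have : ev (dualWord Φ z) ∘ₗ
      (FreeAlgebra.lift K (fun i => (wd (Φ.word i) : FA K))).toLinearMap =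
      (wordBasis K).coord z := linearMap_ext_wd fun y => by
    rw [LinearMap.comp_apply, AlgHom.toLinearMap_apply, lift_wd, ev_wd, dualWord_flatMap Φ hN,
      ← wordBasis_apply, Module.Basis.coord_apply, Module.Basis.repr_self, Finsupp.single_apply]
  exact LinearMap.congr_fun this p

/-- The substitution of the words of a dual family is injective modulo every ideal killed by the
product functionals of the family. -/
lemma lift_injective_of_le_annIdeal (hN : 1 ≤ N) {I : TwoSidedIdeal (FA K)}
    (hI : I ≤ annIdeal (⋃ k, (blk N (Set.range Φ.fn) k : Set (List (Fin 2) → K)))) :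
    Function.Injective fun p : FA K =>
      ((FreeAlgebra.lift K (fun i => (wd (Φ.word i) : FA K)) p : FA K) : I.ringCon.Quotient) := by
  intro p q hpq
  have h := hI ((TwoSidedIdeal.rel_iff _ _ _).mp (I.ringCon.eq.mp hpq))
  refine (wordBasis K).repr.injective (Finsupp.ext fun z => ?_)
  rw [← ev_dualWord_lift Φ hN, ← ev_dualWord_lift Φ hN, ← sub_eq_zero, ← map_sub]
  simpa using mem_annIdeal.mp h _ (Set.mem_iUnion_of_mem _ (dualWord_mem_blk Φ z)) 1 1

end lift

/-- A functional on words which is supported on the words of length divisible by `N`, which is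
multiplicative, and which takes the value `1` at some word of length `N`. -/
structure IsMult (N : ℕ) (Ψ : List (Fin 2) → K) : Prop where
  pos : 1 ≤ N
  append_left : ∀ u v, N ∣ u.length → Ψ (u ++ v) = Ψ u * Ψ v
  eq_zero : ∀ u, ¬ N ∣ u.length → Ψ u = 0
  nil : Ψ [] = 1
  exists_word : ∃ m : List (Fin 2), m.length = N ∧ Ψ m = 1

/-- The tensor powers of a functional. -/
def tensPow (N : ℕ) (φ : List (Fin 2) → K) : ℕ → List (Fin 2) → K
  | 0 => fun w => if w = [] then 1 else 0
  | k + 1 => tens N φ (tensPow N φ k)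

lemma tensPow_mem_blk {N : ℕ} {S : Set (List (Fin 2) → K)} {φ : List (Fin 2) → K} (hφ : φ ∈ S)
    (k : ℕ) : tensPow N φ k ∈ blk N S k := by
  induction k with
  | zero => exact Submodule.subset_span rfl
  | succ k ih => exact tens_mem_blk (Submodule.subset_span hφ) ih

lemma tensPow_append {N : ℕ} (φ : List (Fin 2) → K) (i j : ℕ) (u v : List (Fin 2))
    (hu : u.length = i * N) :
    tensPow N φ (i + j) (u ++ v) = tensPow N φ i u * tensPow N φ j v := by
  induction i generalizing u with
  | zero =>
    obtain rfl : u = [] := List.length_eq_zero_iff.mp (by simpa using hu)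
    simp [tensPow]
  | succ i ih =>
    have h1 : (u.take N).length = N := by
      rw [List.length_take, hu]
      exact min_eq_left (Nat.le_mul_of_pos_left N (Nat.succ_pos i))
    have h2 : (u.drop N).length = i * N := by
      rw [List.length_drop, hu, Nat.succ_mul, Nat.add_sub_cancel]
    rw [Nat.add_right_comm]
    conv_lhs => rw [← List.take_append_drop N u, List.append_assoc]
    rw [tensPow, tens_append _ _ h1, ih _ h2, tensPow, tens, mul_assoc]

/-- The sum of all tensor powers of a functional. -/
def tensSum (N : ℕ) (φ : List (Fin 2) → K) : List (Fin 2) → K :=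
  fun w => if N ∣ w.length then tensPow N φ (w.length / N) w else 0

lemma isMult_tensSum {N : ℕ} (hN : 1 ≤ N) {φ : List (Fin 2) → K} {m : List (Fin 2)}
    (hm : m.length = N) (hφ : φ m = 1) : IsMult N (tensSum N φ) where
  pos := hN
  append_left u v hu := by
    by_cases hv : N ∣ v.length
    · have h : N ∣ (u ++ v).length := by
        rw [List.length_append]
        exact dvd_add hu hv
      rw [tensSum, tensSum, tensSum, if_pos h, if_pos hu, if_pos hv, List.length_append,
        Nat.add_div_of_dvd_right hu, tensPow_append _ _ _ _ _ (Nat.div_mul_cancel hu).symm]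
    · have h : ¬ N ∣ (u ++ v).length := by
        rwa [List.length_append, Nat.dvd_add_right hu]
      rw [tensSum, tensSum, tensSum, if_neg h, if_neg hv, mul_zero]
  eq_zero u hu := if_neg hu
  nil := by simp [tensSum, tensPow]
  exists_word := by
    refine ⟨m, hm, ?_⟩
    rw [tensSum, hm, if_pos dvd_rfl, Nat.div_self hN]
    simp [tensPow, tens, ← hm, hφ]

lemma trunc_tensSum_mem {N : ℕ} {S : Set (List (Fin 2) → K)}
    {φ : List (Fin 2) → K} (hφ : φ ∈ S) (hS : ∀ φ ∈ S, ∀ w, w.length ≠ N → φ w = 0) (n : ℕ) :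
    ∃ k, trunc n (tensSum N φ) ∈ blk N S k := by
  refine ⟨n / N, ?_⟩
  by_cases hn : N ∣ n
  · convert tensPow_mem_blk hφ (n / N) using 1
    funext w
    rw [trunc]
    split_ifs with hw
    · rw [tensSum, hw, if_pos hn]
    · exact (blk_eq_zero hS _ _ (tensPow_mem_blk hφ (n / N)) w
        (by rwa [Nat.div_mul_cancel hn])).symm
  · convert zero_mem (blk N S (n / N))
    funext w
    rw [trunc]
    split_ifs with hw
    · exact if_neg (hw ▸ hn)
    · rfl

/-- The largest homogeneous ideal killed by a functional. -/
def kerIdeal (Ψ : List (Fin 2) → K) : TwoSidedIdeal (FA K) :=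
  annIdeal (Set.range fun n => trunc n Ψ)

lemma mem_kerIdeal {Ψ : List (Fin 2) → K} {p : FA K} :
    p ∈ kerIdeal Ψ ↔ ∀ n, ∀ u v, ev Ψ (comp n (wd u * p * wd v)) = 0 := by
  simp only [kerIdeal, mem_annIdeal_iff_wd, Set.forall_mem_range, ev_comp]

lemma annIdeal_anti {X X' : Set (List (Fin 2) → K)} (h : X ⊆ X') : annIdeal X' ≤ annIdeal X :=
  fun _ hp => mem_annIdeal.mpr fun χ hχ => mem_annIdeal.mp hp χ (h hχ)

lemma mem_kerIdeal_of_mem_Adeg {Ψ : List (Fin 2) → K} {d : ℕ} {p : FA K} (hp : p ∈ Adeg K d) :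
    p ∈ kerIdeal Ψ ↔ ∀ u v, ev Ψ (wd u * p * wd v) = 0 := by
  have h : ∀ u v : List (Fin 2), wd u * p * wd v ∈ Adeg K (u.length + d + v.length) := fun u v =>
    Adeg_mul (Adeg_mul (wd_mem_Adeg u) hp) (wd_mem_Adeg v)
  rw [mem_kerIdeal]
  refine ⟨fun H u v => ?_, fun H n u v => ?_⟩
  · have := H (u.length + d + v.length) u v
    rwa [comp_of_mem (h u v), if_pos rfl] at this
  · rw [comp_of_mem (h u v)]
    split_ifs
    · exact H u v
    · exact map_zero _

lemma comp_mul_mul (n : ℕ) (u v : List (Fin 2)) (p : FA K) :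
    comp (u.length + n + v.length) (wd u * p * wd v) = wd u * comp n p * wd v := by
  have : comp (u.length + n + v.length) ∘ₗ LinearMap.mulRight K (wd v : FA K) ∘ₗ
      LinearMap.mulLeft K (wd u) = LinearMap.mulRight K (wd v) ∘ₗ LinearMap.mulLeft K (wd u) ∘ₗ
      comp n := linearMap_ext_wd fun w => by
    simp only [LinearMap.comp_apply, LinearMap.mulLeft_apply, LinearMap.mulRight_apply,
      ← wd_append, comp_wd, List.length_append]
    by_cases hw : w.length = n
    · rw [if_pos hw, if_pos (by omega), wd_append, wd_append]
    · rw [if_neg hw, if_neg (by omega), mul_zero, zero_mul]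
  exact LinearMap.congr_fun this p

lemma comp_mem_kerIdeal {Ψ : List (Fin 2) → K} {p : FA K} (hp : p ∈ kerIdeal Ψ) (n : ℕ) :
    comp n p ∈ kerIdeal Ψ := by
  rw [mem_kerIdeal_of_mem_Adeg (comp_mem_Adeg n p)]
  intro u v
  rw [← comp_mul_mul]
  exact mem_kerIdeal.mp hp _ u v

lemma isHomogTSI_kerIdeal (Ψ : List (Fin 2) → K) : IsHomogTSI K (kerIdeal Ψ) := by
  intro p hp
  obtain ⟨s, hs⟩ := exists_sum_comp p
  rw [SetLike.mem_coe, ← hs]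
  exact Submodule.sum_mem _ fun n _ =>
    Submodule.subset_span ⟨comp_mem_kerIdeal hp n, n, comp_mem_Adeg n p⟩

lemma exists_comp_notMem {Ψ : List (Fin 2) → K} {p : FA K} (hp : p ∉ kerIdeal Ψ) :
    ∃ n, comp n p ∉ kerIdeal Ψ := by
  by_contra! h
  obtain ⟨s, hs⟩ := exists_sum_comp p
  exact hp (hs ▸ sum_mem fun n _ => h n)

lemma comp_mul (n : ℕ) (p q : FA K) :
    comp n (p * q) = ∑ ij ∈ Finset.HasAntidiagonal.antidiagonal n, comp ij.1 p * comp ij.2 q := by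
  have h1 : ∀ u : List (Fin 2), comp n ∘ₗ LinearMap.mulLeft K (wd u : FA K) =
      ∑ ij ∈ Finset.HasAntidiagonal.antidiagonal n,
        LinearMap.mulLeft K (comp ij.1 (wd u)) ∘ₗ comp ij.2 := by
    refine fun u => linearMap_ext_wd fun v => ?_
    simp only [LinearMap.comp_apply, LinearMap.mulLeft_apply, LinearMap.sum_apply, ← wd_append,
      comp_wd, List.length_append]
    split_ifs with huv
    · rw [Finset.sum_eq_single_of_mem (u.length, v.length)
        (Finset.HasAntidiagonal.mem_antidiagonal.mpr huv), if_pos rfl, if_pos rfl, wd_append]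
      rintro ⟨i, j⟩ - hij
      by_cases hi : u.length = i
      · rw [if_neg (c := v.length = j) (fun hj => hij (by rw [hi, hj])), mul_zero]
      · rw [if_neg hi, zero_mul]
    · refine (Finset.sum_eq_zero ?_).symm
      rintro ⟨i, j⟩ hij
      rw [Finset.HasAntidiagonal.mem_antidiagonal] at hij
      by_cases hi : u.length = i
      · rw [if_neg (c := v.length = j) (fun hj => huv (by rw [hi, hj, hij])), mul_zero]
      · rw [if_neg hi, zero_mul]
  have h2 : comp n ∘ₗ LinearMap.mulRight K q =
      ∑ ij ∈ Finset.HasAntidiagonal.antidiagonal n,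
        LinearMap.mulRight K (comp ij.2 q) ∘ₗ comp ij.1 := by
    refine linearMap_ext_wd fun u => ?_
    have := LinearMap.congr_fun (h1 u) q
    simpa [LinearMap.sum_apply] using this
  have := LinearMap.congr_fun h2 p
  simpa [LinearMap.sum_apply] using this

lemma comp_wd_mul (u : List (Fin 2)) (n : ℕ) (p : FA K) :
    comp (u.length + n) (wd u * p) = wd u * comp n p := by
  simpa using comp_mul_mul n u [] p

lemma comp_wd_mul_of_lt {u : List (Fin 2)} {n : ℕ} (h : n < u.length) (p : FA K) :
    comp n (wd u * p) = 0 := by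
  have : comp n ∘ₗ LinearMap.mulLeft K (wd u : FA K) = 0 := linearMap_ext_wd fun w => by
    rw [LinearMap.comp_apply, LinearMap.mulLeft_apply, ← wd_append, comp_wd, List.length_append,
      if_neg (by omega), LinearMap.zero_apply]
  exact LinearMap.congr_fun this p

lemma mkLin_eq_zero {J : TwoSidedIdeal (FA K)} {p : FA K} :
    mkLin K J.ringCon p = 0 ↔ p ∈ J :=
  J.ringCon.eq.trans (J.mem_iff p).symm

lemma mkLin_surjective (J : TwoSidedIdeal (FA K)) : Function.Surjective (mkLin K J.ringCon) :=
  Quotient.mk_surjective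

/-- Homogeneous lowest terms: if all products `p * x * q` lie in the ideal, so do the products of
the lowest components of `p` and `q` not in the ideal. -/
lemma exists_homogeneous_of_forall_mul_mem {Ψ : List (Fin 2) → K} {p q : FA K}
    (hp : p ∉ kerIdeal Ψ) (hq : q ∉ kerIdeal Ψ) (h : ∀ x, p * x * q ∈ kerIdeal Ψ) :
    ∃ i j, ∃ a ∈ Adeg K i, ∃ b ∈ Adeg K j, a ∉ kerIdeal Ψ ∧ b ∉ kerIdeal Ψ ∧
      ∀ w : List (Fin 2), a * wd w * b ∈ kerIdeal Ψ := by
  have hp' := exists_comp_notMem hp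
  have hq' := exists_comp_notMem hq
  refine ⟨Nat.find hp', Nat.find hq', _, comp_mem_Adeg _ p, _, comp_mem_Adeg _ q,
    Nat.find_spec hp', Nat.find_spec hq', fun w => ?_⟩
  have hpi : ∀ i < Nat.find hp', comp i p ∈ kerIdeal Ψ := fun i hi =>
    not_not.mp (Nat.find_min hp' hi)
  have hqi : ∀ i < Nat.find hq', comp i q ∈ kerIdeal Ψ := fun i hi =>
    not_not.mp (Nat.find_min hq' hi)
  generalize Nat.find hp' = D at hpi
  generalize Nat.find hq' = D' at hqi
  have h1 := comp_mem_kerIdeal (h (wd w)) (D + (w.length + D'))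
  rw [mul_assoc, comp_mul, ← Finset.add_sum_erase _ _
    (Finset.HasAntidiagonal.mem_antidiagonal.mpr rfl : (D, w.length + D') ∈ _),
    comp_wd_mul, ← mul_assoc] at h1
  refine (add_mem_cancel_right (sum_mem fun ij hij => ?_)).mp h1
  obtain ⟨i, j⟩ := ij
  rw [Finset.mem_erase, Finset.HasAntidiagonal.mem_antidiagonal] at hij
  obtain ⟨hne, hij⟩ := hij
  dsimp only at hij ⊢
  by_cases hi : i < D
  · exact (kerIdeal Ψ).mul_mem_right _ _ (hpi i hi)
  · have hi' : i ≠ D := by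
      rintro rfl
      exact hne (Prod.ext rfl (by simpa using hij))
    refine (kerIdeal Ψ).mul_mem_left _ _ ?_
    by_cases hj : j < w.length
    · rw [comp_wd_mul_of_lt hj]
      exact zero_mem _
    · obtain ⟨k, rfl⟩ := Nat.exists_eq_add_of_le (not_lt.mp hj)
      rw [comp_wd_mul]
      exact (kerIdeal Ψ).mul_mem_left _ _ (hqi k (by omega))

namespace IsMult

variable {N : ℕ} {Ψ : List (Fin 2) → K}

lemma append_right (h : IsMult N Ψ) (u v : List (Fin 2)) (hv : N ∣ v.length) :
    Ψ (u ++ v) = Ψ u * Ψ v := by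
  by_cases hu : N ∣ u.length
  · exact h.append_left u v hu
  · rw [h.eq_zero u hu, zero_mul, h.eq_zero]
    rwa [List.length_append, Nat.dvd_add_left hv]

lemma ev_eq_zero (h : IsMult N Ψ) {i : ℕ} {p : FA K} (hp : p ∈ Adeg K i) (hi : ¬ N ∣ i) :
    ev Ψ p = 0 := by
  refine Adeg_le (P := LinearMap.ker (ev Ψ)) (fun w hw => ?_) hp
  rw [LinearMap.mem_ker, ev_wd, h.eq_zero w (hw ▸ hi)]

lemma ev_mul_left (h : IsMult N Ψ) {i : ℕ} {p : FA K} (hp : p ∈ Adeg K i) (hi : N ∣ i) (q : FA K) :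
    ev Ψ (p * q) = ev Ψ p * ev Ψ q := by
  have : Adeg K i ≤ LinearMap.eqLocus (ev Ψ ∘ₗ LinearMap.mulRight K q)
      (LinearMap.mulRight K (ev Ψ q) ∘ₗ ev Ψ) := Adeg_le fun u hu => by
    have : ev Ψ ∘ₗ LinearMap.mulLeft K (wd u) = Ψ u • ev Ψ := linearMap_ext_wd fun v => by
      simp [← wd_append, h.append_left u v (hu ▸ hi)]
    simpa using LinearMap.congr_fun this q
  exact this hp

lemma ev_mul_right (h : IsMult N Ψ) {i : ℕ} {q : FA K} (hq : q ∈ Adeg K i) (hi : N ∣ i) (p : FA K) :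
    ev Ψ (p * q) = ev Ψ p * ev Ψ q := by
  have : Adeg K i ≤ LinearMap.eqLocus (ev Ψ ∘ₗ LinearMap.mulLeft K p)
      (LinearMap.mulLeft K (ev Ψ p) ∘ₗ ev Ψ) := Adeg_le fun u hu => by
    have : ev Ψ ∘ₗ LinearMap.mulRight K (wd u) = Ψ u • ev Ψ := linearMap_ext_wd fun v => by
      simp [← wd_append, h.append_right v u (hu ▸ hi), mul_comm (Ψ u)]
    simpa [mul_comm] using LinearMap.congr_fun this p
  exact this hq

lemma exists_word_pow (h : IsMult N Ψ) (k : ℕ) :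
    ∃ m : List (Fin 2), m.length = k * N ∧ Ψ m = 1 := by
  obtain ⟨m, hm, hm'⟩ := h.exists_word
  induction k with
  | zero => exact ⟨[], by simp, h.nil⟩
  | succ k ih =>
    obtain ⟨w, hw, hw'⟩ := ih
    refine ⟨w ++ m, by rw [List.length_append, hw, hm, Nat.succ_mul], ?_⟩
    rw [h.append_right _ _ (dvd_of_eq hm.symm), hw', hm', mul_one]

lemma not_finite_quotient (h : IsMult N Ψ) :
    ¬ Module.Finite K (kerIdeal Ψ).ringCon.Quotient := by
  intro hfin
  choose m hm hm' using h.exists_word_pow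
  have hli : LinearIndependent K fun k => mkLin K (kerIdeal Ψ).ringCon (wd (m k)) := by
    rw [linearIndependent_iff']
    intro s g hg k hk
    simp only [← map_smul, ← map_sum] at hg
    have := mem_kerIdeal.mp (mkLin_eq_zero.mp hg) (k * N) [] []
    rw [wd_nil, one_mul, mul_one, map_sum, map_sum, Finset.sum_eq_single_of_mem k hk] at this
    · rwa [map_smul, comp_wd, if_pos (hm k), map_smul, ev_wd, hm', smul_eq_mul, mul_one] at this
    · intro l _ hl
      rw [map_smul, comp_wd, if_neg, smul_zero, map_zero]
      rw [hm]
      exact fun H => hl (Nat.eq_of_mul_eq_mul_right h.pos H)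
  exact not_finite_iff_infinite.mpr inferInstance hli.finite

lemma prime_quotient (h : IsMult N Ψ) (a b : (kerIdeal Ψ).ringCon.Quotient)
    (hab : ∀ x, a * x * b = 0) : a = 0 ∨ b = 0 := by
  obtain ⟨p, rfl⟩ := mkLin_surjective _ a
  obtain ⟨q, rfl⟩ := mkLin_surjective _ b
  rw [mkLin_eq_zero, mkLin_eq_zero]
  by_contra! hpq
  obtain ⟨i, j, a, ha, b, hb, haJ, hbJ, H⟩ := exists_homogeneous_of_forall_mul_mem hpq.1 hpq.2
    fun x => mkLin_eq_zero.mp (hab (mkLin K _ x))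
  rw [mem_kerIdeal_of_mem_Adeg ha] at haJ
  rw [mem_kerIdeal_of_mem_Adeg hb] at hbJ
  push Not at haJ hbJ
  obtain ⟨u, v, huv⟩ := haJ
  obtain ⟨u', v', huv'⟩ := hbJ
  have hdeg := Adeg_mul (Adeg_mul (wd_mem_Adeg u) ha) (wd_mem_Adeg v)
  have hdvd : N ∣ u.length + i + v.length := by
    by_contra hN
    exact huv (h.ev_eq_zero hdeg hN)
  have h1 := (mem_kerIdeal_of_mem_Adeg (Adeg_mul (Adeg_mul ha (wd_mem_Adeg (v ++ u'))) hb)).mp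
    (H (v ++ u')) u v'
  rw [wd_append, show wd u * (a * (wd v * wd u') * b) * wd v' =
    (wd u * a * wd v) * (wd u' * b * wd v') by noncomm_ring, h.ev_mul_left hdeg hdvd] at h1
  exact mul_ne_zero huv huv' h1

lemma mem_kerIdeal_of_short (h : IsMult N Ψ) {d : ℕ} {p : FA K} (hp : p ∈ Adeg K d)
    (H : ∀ u v : List (Fin 2), u.length < N → v.length < N → ev Ψ (wd u * p * wd v) = 0) :
    p ∈ kerIdeal Ψ := by
  rw [mem_kerIdeal_of_mem_Adeg hp]
  intro u v
  have hu : (u.take (u.length - u.length % N)).length = u.length - u.length % N := by simp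
  have hv : (v.drop (v.length % N)).length = v.length - v.length % N := by simp
  rw [← List.take_append_drop (u.length - u.length % N) u,
    ← List.take_append_drop (v.length % N) v, wd_append, wd_append, ← mul_assoc _ (wd _) (wd _),
    mul_assoc (wd _) (wd _) p, mul_assoc (wd _) _ (wd _),
    h.ev_mul_right (wd_mem_Adeg _) (hv.symm ▸ Nat.dvd_sub_mod v.length),
    h.ev_mul_left (wd_mem_Adeg _) (hu.symm ▸ Nat.dvd_sub_mod u.length), H, mul_zero, zero_mul]
  · rw [List.length_drop, Nat.sub_sub_self (Nat.mod_le _ _)]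
    exact Nat.mod_lt _ h.pos
  · exact (List.length_take_le _ _).trans_lt (Nat.mod_lt _ h.pos)

lemma rank_Adeg_quotient_le (h : IsMult N Ψ) :
    ∃ c : ℕ, ∀ n : ℕ, Module.rank K ((Adeg K n).map (mkLin K (kerIdeal Ψ).ringCon)) ≤
      (c : Cardinal) := by
  have : Finite {w : List (Fin 2) // w.length < N} := List.finite_length_lt (Fin 2) N
  have := Fintype.ofFinite {w : List (Fin 2) // w.length < N}
  let B := {w : List (Fin 2) // w.length < N} × {w : List (Fin 2) // w.length < N}
  let T : FA K →ₗ[K] (B → K) := LinearMap.pi fun b =>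
    ev Ψ ∘ₗ LinearMap.mulRight K (wd b.2.1) ∘ₗ LinearMap.mulLeft K (wd b.1.1)
  refine ⟨Fintype.card B, fun n => ?_⟩
  let M := (mkLin K (kerIdeal Ψ).ringCon).domRestrict (Adeg K n)
  let T' := T.domRestrict (Adeg K n)
  have hker : LinearMap.ker T' ≤ LinearMap.ker M := by
    rintro ⟨p, hp⟩ hpT
    refine mkLin_eq_zero.mpr (h.mem_kerIdeal_of_short hp fun u v hu hv => ?_)
    exact congr_fun (LinearMap.mem_ker.mp hpT) (⟨u, hu⟩, ⟨v, hv⟩)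
  have hM : (Adeg K n).map (mkLin K (kerIdeal Ψ).ringCon) = LinearMap.range M := by
    rw [LinearMap.range_domRestrict]
  rw [hM, ← M.quotKerEquivRange.rank_eq]
  calc _ ≤ Module.rank K (Adeg K n ⧸ LinearMap.ker T') :=
        LinearMap.rank_le_of_surjective (Submodule.factor hker) (Submodule.factor_surjective hker)
    _ = Module.rank K (LinearMap.range T') := T'.quotKerEquivRange.rank_eq
    _ ≤ Module.rank K (B → K) := Submodule.rank_le _
    _ = Fintype.card B := rank_fun'

end IsMult

/-- An algebra which is finitely generated as a module under left multiplication by scalars and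
by one element is left Noetherian. -/
lemma isNoetherianRing_of_mul_generated {R : Type*} [Ring R] [Algebra K R] (z : R) {s : Set R}
    (hs : s.Finite)
    (H : ∀ P : Submodule K R, s ⊆ P → (∀ p ∈ P, z * p ∈ P) → P = ⊤) : IsNoetherianRing R := by
  let _ : Module (Polynomial K) R := Module.compHom R (Polynomial.aeval (R := K) z).toRingHom
  have hsmul : ∀ (p : Polynomial K) (r : R), p • r = Polynomial.aeval z p * r := fun _ _ => rfl
  have : IsScalarTower (Polynomial K) R R := ⟨fun p r t => by
    rw [hsmul, hsmul, smul_eq_mul, smul_eq_mul, mul_assoc]⟩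
  have hfin : Module.Finite (Polynomial K) R := by
    refine ⟨Submodule.fg_def.mpr ⟨s, hs, ?_⟩⟩
    have : IsScalarTower K (Polynomial K) R := ⟨fun k p r => by
      rw [hsmul, hsmul, map_smul, smul_mul_assoc]⟩
    have h := H ((Submodule.span (Polynomial K) s).restrictScalars K) Submodule.subset_span
      fun p hp => by
        have := Submodule.smul_mem (Submodule.span (Polynomial K) s) Polynomial.X hp
        rwa [hsmul, Polynomial.aeval_X] at this
    rwa [Submodule.restrictScalars_eq_top_iff] at h
  exact isNoetherian_of_tower (Polynomial K) inferInstance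

lemma exists_forall_add_eq {a : ℕ → ℕ} {N c : ℕ} (ha : ∀ n, a n ≤ a (n + N)) (hc : ∀ n, a n ≤ c) :
    ∃ n₀, ∀ n, n₀ ≤ n → a (n + N) = a n := by
  let S : ℕ → ℕ := fun n => ∑ i ∈ Finset.range N, a (n + i)
  have hS : ∀ n, S (n + 1) + a n = S n + a (n + N) := fun n => by
    rw [← Finset.sum_range_succ, Finset.sum_range_succ', add_zero]
    simp only [S, add_assoc, add_comm 1]
  have hmono : Monotone S := monotone_nat_of_le_succ fun n => by
    have := hS n
    have := ha n
    omega
  have hbd : ∀ n, S n ≤ N * c := fun n => by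
    simpa using Finset.sum_le_sum fun i (_ : i ∈ Finset.range N) => hc (n + i)
  refine ⟨Function.argmin fun n => N * c - S n, fun n hn => ?_⟩
  have h1 := Function.argmin_le (fun n => N * c - S n) (n + 1)
  have h2 := hmono hn
  have h3 := hbd (n + 1)
  have h4 := hS n
  have h5 := ha n
  have h6 := hmono (Nat.le_add_right n 1)
  have h7 := hbd n
  omega

lemma finite_setOf_not_isUnit_add_smul {F : Type*} [AddCommGroup F] [Module K F]
    [FiniteDimensional K F] {A B : Module.End K F} (h : IsUnit A ∨ IsUnit B) :
    {t : K | ¬ IsUnit (A + t • B)}.Finite := by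
  rcases h with ⟨A, rfl⟩ | ⟨B, rfl⟩
  · refine (((Module.End.finite_spectrum ((↑A⁻¹ : Module.End K F) * B)).image
      fun t => -t⁻¹).insert 0).subset fun t ht => ?_
    rw [Set.mem_insert_iff, or_iff_not_imp_left]
    intro ht0
    refine ⟨-t⁻¹, fun hu => ht ?_, by simp⟩
    have h1 : (A : Module.End K F) + t • B =
        (A : Module.End K F) * (-t • (algebraMap K (Module.End K F) (-t⁻¹) - ↑A⁻¹ * B)) := by
      rw [smul_sub, mul_sub, Algebra.algebraMap_eq_smul_one, smul_smul, mul_smul_comm,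
        mul_smul_comm, Units.mul_inv_cancel_left]
      simp [ht0]
    rw [h1]
    exact A.isUnit.mul (hu.smul (Units.mk0 (-t) (neg_ne_zero.mpr ht0)))
  · refine ((Module.End.finite_spectrum (A * (↑B⁻¹ : Module.End K F))).image
      fun t => -t).subset fun t ht => ?_
    refine ⟨-t, fun hu => ht ?_, neg_neg t⟩
    have h1 : A + t • (B : Module.End K F) =
        -(algebraMap K (Module.End K F) (-t) - A * ↑B⁻¹) * B := by
      rw [neg_mul, sub_mul, Units.inv_mul_cancel_right, Algebra.algebraMap_eq_smul_one]
      simp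
    rw [h1]
    exact hu.neg.mul B.isUnit

lemma exists_forall_isUnit [Infinite K] {V : Type*} [AddCommGroup V] [Module K V] {ι : Type*}
    {F : ι → Type*} [∀ i, AddCommGroup (F i)] [∀ i, Module K (F i)]
    [∀ i, FiniteDimensional K (F i)] (T : ∀ i, V →ₗ[K] Module.End K (F i)) (s : Finset ι)
    (h : ∀ i ∈ s, ∃ v, IsUnit (T i v)) : ∃ v, ∀ i ∈ s, IsUnit (T i v) := by
  induction s using Finset.induction_on with
  | empty => exact ⟨0, by simp⟩
  | insert i s _ ih =>
    obtain ⟨v, hv⟩ := ih fun j hj => h j (Finset.mem_insert_of_mem hj)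
    obtain ⟨w, hw⟩ := h i (Finset.mem_insert_self i s)
    have hfin : (⋃ j ∈ insert i s, {t : K | ¬ IsUnit (T j v + t • T j w)}).Finite := by
      refine Set.Finite.biUnion (Finset.finite_toSet _) fun j hj => ?_
      refine finite_setOf_not_isUnit_add_smul ?_
      rcases Finset.mem_insert.mp hj with rfl | hj
      · exact Or.inr hw
      · exact Or.inl (hv j hj)
    obtain ⟨t, ht⟩ := hfin.exists_notMem
    refine ⟨v + t • w, fun j hj => ?_⟩
    rw [map_add, map_smul]
    by_contra hu
    exact ht (Set.mem_biUnion hj hu)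

instance finiteDimensional_Adeg (n : ℕ) : FiniteDimensional K (Adeg K n) := by
  refine FiniteDimensional.span_of_finite K
    (((List.finite_length_eq (Fin 2) n).image wd).subset ?_)
  rintro _ ⟨w, hw, rfl⟩
  exact ⟨w, hw, rfl⟩

lemma wd_mem_Adeg_of_length_eq {w : List (Fin 2)} {n : ℕ} (hw : w.length = n) :
    (wd w : FA K) ∈ Adeg K n :=
  hw ▸ wd_mem_Adeg w

/-- The linear form `q ↦ Ψ (a * q)` attached to an element `a`. -/
def leftForm (Ψ : List (Fin 2) → K) : FA K →ₗ[K] (FA K → K) :=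
  LinearMap.pi fun q => ev Ψ ∘ₗ LinearMap.mulRight K q

lemma leftForm_apply (Ψ : List (Fin 2) → K) (a q : FA K) : leftForm Ψ a q = ev Ψ (a * q) := rfl

/-- The space of linear forms attached to the homogeneous elements of degree `i`. -/
abbrev leftForms (Ψ : List (Fin 2) → K) (i : ℕ) : Submodule K (FA K → K) :=
  (Adeg K i).map (leftForm Ψ)

namespace IsMult

variable {N : ℕ} {Ψ : List (Fin 2) → K}

lemma leftForm_mul (h : IsMult N Ψ) {n : ℕ} {a : FA K} (ha : a ∈ Adeg K n) (hn : N ∣ n) (b : FA K) :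
    leftForm Ψ (a * b) = ev Ψ a • leftForm Ψ b := by
  refine funext fun q => ?_
  rw [leftForm_apply, mul_assoc, h.ev_mul_left ha hn, Pi.smul_apply, leftForm_apply, smul_eq_mul]

lemma leftForm_mem (h : IsMult N Ψ) {i k : ℕ} (hk : N ∣ k) {a : FA K} (ha : a ∈ Adeg K (k + i)) :
    leftForm Ψ a ∈ leftForms Ψ i := by
  refine Adeg_le (P := (leftForms Ψ i).comap (leftForm Ψ)) (fun w hw => ?_) ha
  have hw' : (w.take k).length = k := by simp [hw]
  rw [Submodule.mem_comap, ← List.take_append_drop k w, wd_append,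
    h.leftForm_mul (wd_mem_Adeg_of_length_eq hw') hk]
  exact Submodule.smul_mem _ _ ⟨_, wd_mem_Adeg_of_length_eq (by simp [hw]), rfl⟩

lemma leftForm_comp_mem (h : IsMult N Ψ) (i : ℕ) {z : FA K} (hz : z ∈ Adeg K N)
    {F : FA K → K} (hF : F ∈ leftForms Ψ i) : (fun q => F (z * q)) ∈ leftForms Ψ i := by
  obtain ⟨a, ha, rfl⟩ := hF
  have : (fun q => leftForm Ψ a (z * q)) = leftForm Ψ (a * z) := funext fun q => by
    simp [leftForm_apply, mul_assoc]
  rw [this]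
  exact h.leftForm_mem dvd_rfl (add_comm N i ▸ Adeg_mul ha hz)

/-- The action of the elements of degree `N` on the linear forms attached to the elements of
degree `i`. -/
def leftAction (h : IsMult N Ψ) (i : ℕ) : Adeg K N →ₗ[K] Module.End K (leftForms Ψ i) where
  toFun z :=
    { toFun := fun F => ⟨_, h.leftForm_comp_mem i z.2 F.2⟩
      map_add' := fun _ _ => rfl
      map_smul' := fun _ _ => rfl }
  map_add' z z' := by
    refine LinearMap.ext fun ⟨F, hF⟩ => Subtype.ext (funext fun q => ?_)
    obtain ⟨a, ha, rfl⟩ := hF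
    simp [leftForm_apply, add_mul, mul_add]
  map_smul' c z := by
    refine LinearMap.ext fun ⟨F, hF⟩ => Subtype.ext (funext fun q => ?_)
    obtain ⟨a, ha, rfl⟩ := hF
    simp [leftForm_apply]

lemma leftForm_eq_zero (h : IsMult N Ψ) {i : ℕ} (hi : i < N) {F : FA K → K}
    (hF : F ∈ leftForms Ψ i) (H : ∀ v ∈ Adeg K (N - i), F v = 0) : F = 0 := by
  obtain ⟨a, ha, rfl⟩ := hF
  suffices ev Ψ ∘ₗ LinearMap.mulLeft K a = 0 from funext fun q => LinearMap.congr_fun this q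
  refine linearMap_ext_wd fun w => ?_
  rw [LinearMap.zero_apply, LinearMap.comp_apply, LinearMap.mulLeft_apply]
  by_cases hN : N ∣ i + w.length
  · obtain ⟨m, hm, hm'⟩ := h.exists_word
    have h1 : ev Ψ (a * wd w) = ev Ψ (a * (wd w * wd m)) := by
      rw [← mul_assoc, h.ev_mul_right (wd_mem_Adeg_of_length_eq hm) dvd_rfl, ev_wd, hm', mul_one]
    have ht : ((w ++ m).take (N - i)).length = N - i := by simp; omega
    have hd : N ∣ ((w ++ m).drop (N - i)).length := by
      rw [List.length_drop, List.length_append, hm,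
        show w.length + N - (N - i) = i + w.length by omega]
      exact hN
    rw [h1, ← wd_append, ← List.take_append_drop (N - i) (w ++ m), wd_append, ← mul_assoc,
      h.ev_mul_right (wd_mem_Adeg _) hd, ← leftForm_apply, H _ (wd_mem_Adeg_of_length_eq ht),
      zero_mul]
  · exact h.ev_eq_zero (Adeg_mul ha (wd_mem_Adeg w)) hN

lemma exists_leftAction_eq_one (h : IsMult N Ψ) {i : ℕ} (hi : i < N) :
    ∃ z, h.leftAction i z = 1 := by
  have hadd : ∀ F ∈ leftForms Ψ i, ∀ p q, F (p + q) = F p + F q := by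
    rintro _ ⟨a, -, rfl⟩ p q
    simp [leftForm_apply, mul_add]
  have hsmul : ∀ F ∈ leftForms Ψ i, ∀ (c : K) p, F (c • p) = c • F p := by
    rintro _ ⟨a, -, rfl⟩ c p
    simp [leftForm_apply]
  let C : leftForms Ψ i →ₗ[K] Adeg K (N - i) →ₗ[K] K :=
    LinearMap.mk₂ K (fun F v => F.1 v) (fun _ _ _ => rfl) (fun _ _ _ => rfl)
      (fun F _ _ => hadd _ F.2 _ _) fun c F _ => hsmul _ F.2 c _
  have hC : Function.Surjective C.flip := by
    refine (LinearMap.flip_injective_iff₁ (B := C.flip)).mp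
      ((injective_iff_map_eq_zero _).mpr fun F hF => ?_)
    exact Subtype.ext (h.leftForm_eq_zero hi F.2 fun v hv => LinearMap.congr_fun hF ⟨v, hv⟩)
  let b := Module.finBasis K (leftForms Ψ i)
  choose a ha hab using fun k => (b k).2
  choose v hv using fun k => hC (b.coord k)
  have hz : ∑ k, (v k : FA K) * a k ∈ Adeg K N := Submodule.sum_mem _ fun k _ => by
    simpa only [Nat.sub_add_cancel hi.le] using Adeg_mul (v k).2 (ha k)
  refine ⟨⟨_, hz⟩, LinearMap.ext fun F => Subtype.ext (funext fun q => ?_)⟩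
  have hF : ∀ k, (F : FA K → K) (v k * (a k * q)) = b.repr F k * leftForm Ψ (a k) q := by
    intro k
    have h1 : (F : FA K → K) (v k) = b.repr F k := LinearMap.congr_fun (hv k) F
    rw [← h1]
    obtain ⟨c, hc, hcF⟩ := F.2
    rw [← hcF, leftForm_apply, leftForm_apply, leftForm_apply, ← mul_assoc,
      h.ev_mul_left (Adeg_mul hc (v k).2) (by rw [Nat.add_sub_cancel' hi.le])]
  calc (F : FA K → K) ((∑ k, (v k : FA K) * a k) * q)
      = ∑ k, b.repr F k * leftForm Ψ (a k) q := by
        simp only [Finset.sum_mul, mul_assoc]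
        obtain ⟨⟨_, c, hc, rfl⟩, rfl⟩ : ∃ G, G = F := ⟨F, rfl⟩
        simp only [leftForm_apply, Finset.mul_sum, map_sum] at hF ⊢
        exact Finset.sum_congr rfl fun k _ => hF k
    _ = ((∑ k, b.repr F k • b k : leftForms Ψ i) : FA K → K) q := by
        rw [Submodule.coe_sum, Finset.sum_apply]
        exact Finset.sum_congr rfl fun k _ => by rw [hab]; rfl
    _ = (F : FA K → K) q := by rw [b.sum_repr]

/-- There is an element of degree `N` which is left regular on homogeneous elements modulo the
ideal. -/
lemma exists_left_regular [Infinite K] (h : IsMult N Ψ) :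
    ∃ z ∈ Adeg K N, ∀ d, ∀ p ∈ Adeg K d, z * p ∈ kerIdeal Ψ → p ∈ kerIdeal Ψ := by
  obtain ⟨z, hz⟩ := exists_forall_isUnit h.leftAction (Finset.range N) fun i hi =>
    (h.exists_leftAction_eq_one (Finset.mem_range.mp hi)).imp fun z hz => by
      rw [hz]
      exact isUnit_one
  refine ⟨z, z.2, fun d p hp hzp => (mem_kerIdeal_of_mem_Adeg hp).mpr fun u v => ?_⟩
  have hu : (wd u : FA K) ∈ Adeg K (N * (u.length / N) + u.length % N) :=
    wd_mem_Adeg_of_length_eq (Nat.div_add_mod _ _).symm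
  have hF := h.leftForm_mem (dvd_mul_right _ _) hu
  obtain ⟨⟨_, c, _, rfl⟩, hc⟩ := ((Module.End.isUnit_iff _).mp
    (hz (u.length % N) (Finset.mem_range.mpr (Nat.mod_lt _ h.pos)))).2 ⟨_, hF⟩
  have h1 : leftForm Ψ c ((z : FA K) * (p * wd v)) = leftForm Ψ (wd u) (p * wd v) :=
    congrFun (congrArg Subtype.val hc) (p * wd v)
  rw [mul_assoc, ← leftForm_apply, ← h1, leftForm_apply, ← mul_assoc, ← mul_assoc, mul_assoc c]
  rw [mem_kerIdeal_of_mem_Adeg (Adeg_mul z.2 hp)] at hzp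
  have h3 : ev Ψ ∘ₗ LinearMap.mulRight K (wd v) ∘ₗ LinearMap.mulRight K ((z : FA K) * p) = 0 :=
    linearMap_ext_wd fun w => hzp w v
  exact LinearMap.congr_fun h3 c

lemma isNoetherianRing_quotient [Infinite K] (h : IsMult N Ψ) :
    IsNoetherianRing (kerIdeal Ψ).ringCon.Quotient := by
  obtain ⟨z, hz, hreg⟩ := h.exists_left_regular
  let π := mkLin K (kerIdeal Ψ).ringCon
  let R : ℕ → Submodule K (kerIdeal Ψ).ringCon.Quotient := fun n => (Adeg K n).map π
  have hmul : ∀ p q, π (p * q) = π p * π q := fun _ _ => rfl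
  have hle : ∀ n, (R n).map (LinearMap.mulLeft K (π z)) ≤ R (n + N) := by
    rintro n _ ⟨_, ⟨p, hp, rfl⟩, rfl⟩
    exact ⟨z * p, add_comm N n ▸ Adeg_mul hz hp, rfl⟩
  have hinj : ∀ n, Module.finrank K ((R n).map (LinearMap.mulLeft K (π z))) =
      Module.finrank K (R n) := fun n => by
    rw [← LinearMap.range_domRestrict]
    refine LinearMap.finrank_range_of_inj ((injective_iff_map_eq_zero _).mpr ?_)
    rintro ⟨_, p, hp, rfl⟩ hzp
    exact Subtype.ext (mkLin_eq_zero.mpr (hreg n p hp (mkLin_eq_zero.mp hzp)))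
  obtain ⟨c, hc⟩ := h.rank_Adeg_quotient_le
  obtain ⟨n₀, hn₀⟩ := exists_forall_add_eq (a := fun n => Module.finrank K (R n)) (N := N)
    (c := c) (fun n => (hinj n).symm.trans_le (Submodule.finrank_mono (hle n)))
    fun n => Module.finrank_le_of_rank_le (hc n)
  have heq : ∀ n, n₀ ≤ n → (R n).map (LinearMap.mulLeft K (π z)) = R (n + N) := fun n hn =>
    Submodule.eq_of_le_of_finrank_eq (hle n) ((hinj n).trans (hn₀ n hn).symm)
  refine isNoetherianRing_of_mul_generated (K := K) (π z)
    (s := π '' (wd '' {w | w.length < n₀ + N}))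
    (((List.finite_length_lt (Fin 2) (n₀ + N)).image _).image _) fun P hP hzP => ?_
  have hR : ∀ n, R n ≤ P := by
    intro n
    induction n using Nat.strong_induction_on with
    | _ n ih =>
      by_cases hn : n < n₀ + N
      · refine Submodule.map_le_iff_le_comap.mpr (Adeg_le fun w hw => hP ?_)
        exact ⟨wd w, ⟨w, hw.trans_lt hn, rfl⟩, rfl⟩
      · have hpos := h.pos
        obtain ⟨m, rfl⟩ := Nat.exists_eq_add_of_le' (show N ≤ n by omega)
        rw [← heq m (by omega)]
        rintro _ ⟨r, hr, rfl⟩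
        exact hzP r (ih m (by omega) hr)
  refine eq_top_iff.mpr fun r _ => ?_
  obtain ⟨p, rfl⟩ := mkLin_surjective _ r
  obtain ⟨s, hs⟩ := exists_sum_comp p
  rw [← hs, map_sum]
  exact Submodule.sum_mem _ fun n _ => hR n ⟨_, comp_mem_Adeg n p, rfl⟩

end IsMult

lemma star_wd (w : List (Fin 2)) : star (wd w : FA K) = wd w.reverse := by
  induction w with
  | nil => exact star_one _
  | cons i w ih =>
    rw [← List.singleton_append, wd_append, star_mul, ih, List.reverse_append, wd_append]
    simp [wd]

/-- The word reversal of the free algebra as a linear map. -/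
def starLin : FA K →ₗ[K] FA K where
  toFun p := star p
  map_add' p q := star_add p q
  map_smul' c p := by
    rw [Algebra.smul_def, star_mul, FreeAlgebra.star_algebraMap, ← Algebra.commutes,
      ← Algebra.smul_def, RingHom.id_apply]

lemma starLin_apply (p : FA K) : starLin p = star p := rfl

lemma ev_star (Ψ : List (Fin 2) → K) (p : FA K) :
    ev Ψ (star p) = ev (fun w => Ψ w.reverse) p := by
  have : ev Ψ ∘ₗ starLin = ev fun w => Ψ w.reverse := linearMap_ext_wd fun w => by
    rw [LinearMap.comp_apply, starLin_apply, star_wd, ev_wd, ev_wd]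
  exact LinearMap.congr_fun this p

lemma comp_star (n : ℕ) (p : FA K) : comp n (star p) = star (comp n p) := by
  have : comp n ∘ₗ starLin = starLin (K := K) ∘ₗ comp n := linearMap_ext_wd fun w => by
    rw [LinearMap.comp_apply, LinearMap.comp_apply, starLin_apply, star_wd, comp_wd, comp_wd,
      List.length_reverse]
    split_ifs
    · rw [starLin_apply, star_wd]
    · rw [map_zero]
  exact LinearMap.congr_fun this p

lemma star_mem_kerIdeal {Ψ : List (Fin 2) → K} {p : FA K}
    (hp : p ∈ kerIdeal fun w => Ψ w.reverse) : star p ∈ kerIdeal Ψ := by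
  refine mem_kerIdeal.mpr fun n u v => ?_
  have := mem_kerIdeal.mp hp n v.reverse u.reverse
  rw [← ev_star, ← comp_star, star_mul, star_mul, star_wd, star_wd, List.reverse_reverse,
    List.reverse_reverse, ← mul_assoc] at this
  exact this

namespace IsMult

variable {N : ℕ} {Ψ : List (Fin 2) → K}

lemma reverse (h : IsMult N Ψ) : IsMult N fun w => Ψ w.reverse where
  pos := h.pos
  append_left u v hu := by
    rw [List.reverse_append, h.append_right _ _ (by simpa using hu), mul_comm]
  eq_zero u hu := h.eq_zero _ (by simpa using hu)
  nil := h.nil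
  exists_word := h.exists_word.imp' List.reverse fun m hm => by simpa using hm

lemma isNoetherianRing_quotient_op [Infinite K] (h : IsMult N Ψ) :
    IsNoetherianRing (kerIdeal Ψ).ringCon.Quotientᵐᵒᵖ := by
  have := h.reverse.isNoetherianRing_quotient
  let g : FA K →+* (kerIdeal Ψ).ringCon.Quotientᵐᵒᵖ :=
    (RingHom.op (kerIdeal Ψ).ringCon.mk').comp (FreeAlgebra.starHom : FA K ≃ₐ[K] (FA K)ᵐᵒᵖ)
  have hg : ∀ p, g p = MulOpposite.op (mkLin K (kerIdeal Ψ).ringCon (star p)) := fun _ => rfl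
  let G := (kerIdeal fun w => Ψ w.reverse).ringCon.lift g fun p q hpq => by
    rw [RingCon.ker_apply, ← sub_eq_zero, ← map_sub, hg, MulOpposite.op_eq_zero_iff, mkLin_eq_zero]
    exact star_mem_kerIdeal ((TwoSidedIdeal.rel_iff _ _ _).mp hpq)
  refine isNoetherianRing_of_surjective _ _ G fun r => ?_
  obtain ⟨p, hp⟩ := mkLin_surjective _ r.unop
  refine ⟨mkLin K _ (star p), ?_⟩
  change MulOpposite.op (mkLin K (kerIdeal Ψ).ringCon (star (star p))) = r
  rw [star_star, hp, MulOpposite.op_unop]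

end IsMult

end

/-- **Theorem 7.1.** -/
theorem statement1 [IsAlgClosed K]
    (ξ : ℕ) (f : Fin ξ → FA K) (d : Fin ξ → ℕ)
    (hpos : ∀ j, 1 ≤ d j) (hhom : ∀ j, f j ∈ Adeg K (d j))
    (r : ℕ → ℕ)
    (hr : ∀ i, r i = (Finset.univ.filter fun j => 2 ^ i < d j ∧ d j ≤ 2 ^ (i + 1)).card)
    (Y : Set ℕ) (hYdef : Y = {i : ℕ | 1 ≤ i ∧ r i ≠ 0})
    (hdeg : ∀ j, ∃ n : ℕ, 2 ≤ n ∧ 2 ^ n + 2 ^ (n - 1) ≤ d j ∧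
      d j ≤ 2 ^ n + 2 ^ (n - 1) + 2 ^ (n - 2))
    (I : TwoSidedIdeal (FA K)) (hI : I = TwoSidedIdeal.span (Set.range f))
    (e : ℕ → ℕ) (he : ∀ n ∈ Y, 1 ≤ e n ∧ e n ≤ n - 1)
    (hdisj : ∀ n ∈ Y, ∀ m ∈ Y, n ≠ m →
      Disjoint (Set.Icc (n - e n - 1) (n - 1)) (Set.Icc (m - e m - 1) (m - 1)))
    (hbound : ∀ n ∈ Y,
      r n * 2 ^ (3 * n + 4) *
        (∏ k ∈ Finset.range n, if k ∈ Y then 2 ^ 2 ^ (e k + 2) else 1) ≤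
      2 ^ 2 ^ (e n - 1)) :
    -- (a) two monomials of the same degree whose images in `A/I` generate a free subalgebra
    (∃ (k : ℕ) (m₁ m₂ : FA K), 1 ≤ k ∧ m₁ ∈ Mon K k ∧ m₂ ∈ Mon K k ∧
      Function.Injective (fun p : FreeAlgebra K (Fin 2) =>
        ((FreeAlgebra.lift K ![m₁, m₂]) p : I.ringCon.Quotient))) ∧
    -- (b) a homogeneous two-sided ideal `J ⊇ I` with `A/J` infinite-dimensional, prime,
    -- left and right Noetherian, of linear growth
    (∃ J : TwoSidedIdeal (FA K), I ≤ J ∧ IsHomogTSI K J ∧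
      ¬ Module.Finite K J.ringCon.Quotient ∧
      (∀ a b : J.ringCon.Quotient, (∀ x, a * x * b = 0) → a = 0 ∨ b = 0) ∧
      IsNoetherianRing J.ringCon.Quotient ∧
      IsNoetherianRing (J.ringCon.Quotient)ᵐᵒᵖ ∧
      (∃ c : ℕ, ∀ n : ℕ,
        Module.rank K ((Adeg K n).map (mkLin K J.ringCon)) ≤ (c : Cardinal))) := by
  subst hI
  have hcard : ∀ m, r (m + 1) = Fintype.card (RelAt d m) := fun m => by
    rw [hr, Fintype.card_subtype]
  have hmem : ∀ m, Nonempty (RelAt d m) → m + 1 ∈ Y := fun m hm => by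
    rw [hYdef]
    exact ⟨Nat.succ_pos m, by rw [hcard]; exact Fintype.card_ne_zero⟩
  have hδ : ∀ j, ∃ m, 3 * 2 ^ m ≤ d j ∧ 2 * d j ≤ 7 * 2 ^ m := fun j => by
    obtain ⟨n, hn, h1, h2⟩ := hdeg j
    obtain ⟨m, rfl⟩ := Nat.exists_eq_add_of_le' hn
    refine ⟨m + 1, ?_, ?_⟩ <;> simp [pow_succ] at h1 h2 ⊢ <;> omega
  obtain ⟨N, hN, Φ, hΦ⟩ := exists_killing_pair_of_sparse (fun j => (wordBasis K).repr (f j)) d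
    (fun j => length_eq_of_repr_ne_zero (hhom j)) hδ
    ⟨fun n hn => (he n hn).1, fun n hn => (he n hn).2, hdisj⟩ hmem
    fun m hm => hcard m ▸ hbound (m + 1) hm
  have hI : TwoSidedIdeal.span (Set.range f) ≤
      annIdeal (⋃ k, (blk N (Set.range Φ.fn) k : Set (List (Fin 2) → K))) :=
    span_le_annIdeal fun j χ hχ => by
      obtain ⟨k, hk⟩ := Set.mem_iUnion.mp hχ
      exact hΦ j k χ hk
  refine ⟨⟨N, wd (Φ.word 0), wd (Φ.word 1), hN, ⟨_, Φ.length_word 0, rfl⟩,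
    ⟨_, Φ.length_word 1, rfl⟩, ?_⟩, ?_⟩
  · have h01 : ![wd (Φ.word 0), wd (Φ.word 1)] = fun i => (wd (Φ.word i) : FA K) := by
      funext i
      fin_cases i <;> rfl
    rw [h01]
    exact lift_injective_of_le_annIdeal Φ hN hI
  · have hΨ : IsMult N (tensSum N (Φ.fn 0)) :=
      isMult_tensSum hN (Φ.length_word 0) (by rw [Φ.dual, if_pos rfl])
    have : Infinite K := inferInstance
    refine ⟨kerIdeal (tensSum N (Φ.fn 0)), hI.trans (annIdeal_anti ?_), isHomogTSI_kerIdeal _,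
      hΨ.not_finite_quotient, hΨ.prime_quotient, hΨ.isNoetherianRing_quotient,
      hΨ.isNoetherianRing_quotient_op, hΨ.rank_Adeg_quotient_le⟩
    rintro _ ⟨n, rfl⟩
    refine Set.mem_iUnion.mpr (trunc_tensSum_mem (Set.mem_range_self 0) ?_ n)
    rintro _ ⟨i, rfl⟩
    exact Φ.fn_eq_zero i

end
end

section
/- Let Y be a set of positive integers and let r_i ≥ 1 (i ∈ Y) be natural numbers such that for all n ∈ Y and all m ∈ {0} ∪ Y with m < n one has 2^{3n+4} · ∏_{i∈Y, i<n} r_i^{32} < r_n < 2^{2^{n-m-3}}. Then there exist natural numbers e(n) for n ∈ Y such that 1 ≤ e(n) ≤ n−1 for all n ∈ Y, such that the sets S_n = {n−e(n)−1, n−e(n), …, n−1} (n ∈ Y) are pairwise disjoint, and such that r_n · 2^{3n+4} · ∏_{k∈Y, k<n} 2^{2^{e(k)+2}} ≤ 2^{2^{e(n)−1}} for all n ∈ Y. -/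
open scoped Classical

/-- `Nat.clog 2 (Nat.clog 2 x)` is the least `j` with `x ≤ 2 ^ 2 ^ j`. -/
theorem clog_clog_le_iff {x j : ℕ} : Nat.clog 2 (Nat.clog 2 x) ≤ j ↔ x ≤ 2 ^ 2 ^ j := by
  rw [Nat.clog_le_iff_le_pow one_lt_two, Nat.clog_le_iff_le_pow one_lt_two]

theorem two_pow_two_pow_clog_clog_le {s : ℕ} (hs : 2 ≤ s) :
    2 ^ 2 ^ (Nat.clog 2 (Nat.clog 2 (s ^ 2)) + 3) ≤ s ^ 32 := by
  obtain hc | ⟨c, hc⟩ : _ ∨ ∃ c, Nat.clog 2 (Nat.clog 2 (s ^ 2)) = c + 1 :=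
    (Nat.eq_zero_or_pos _).imp_right Nat.exists_eq_add_of_le'
  · have := clog_clog_le_iff.1 hc.le
    norm_num at this
    nlinarith
  · have hlt : 2 ^ 2 ^ c < s ^ 2 := by
      rw [← not_le, ← clog_clog_le_iff]
      omega
    calc 2 ^ 2 ^ (Nat.clog 2 (Nat.clog 2 (s ^ 2)) + 3) = (2 ^ 2 ^ c) ^ 16 := by
          rw [hc, ← pow_mul]
          congr 1
          ring
      _ ≤ (s ^ 2) ^ 16 := by gcongr
      _ = s ^ 32 := by ring

theorem clog_clog_add_two_le {s d : ℕ} (hs : 2 ≤ s) (h : s < 2 ^ 2 ^ (d - 3)) :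
    Nat.clog 2 (Nat.clog 2 (s ^ 2)) + 2 ≤ d := by
  have hd : 3 < d := by
    by_contra! hd
    rw [Nat.sub_eq_zero_of_le hd] at h
    omega
  have : Nat.clog 2 (Nat.clog 2 (s ^ 2)) ≤ d - 2 := by
    rw [clog_clog_le_iff]
    calc s ^ 2 ≤ (2 ^ 2 ^ (d - 3)) ^ 2 := by gcongr
      _ = 2 ^ 2 ^ (d - 2) := by
        rw [← pow_mul, ← pow_succ]
        congr 2
        omega
  omega

/-- **Lemma 7.2.**  From the numerical hypotheses of Theorem 0.1 one can produce numbers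
`e(n)` (`n ∈ Y`) with `1 ≤ e(n) ≤ n − 1`, pairwise disjoint sets
`S_n = {n−e(n)−1, …, n−1}`, and
`r_n · 2^{3n+4} · ∏_{k∈Y, k<n} 2^{2^{e(k)+2}} ≤ 2^{2^{e(n)−1}}`. -/
theorem statement2 (Y : Set ℕ) (hY : ∀ n ∈ Y, 1 ≤ n)
    (r : ℕ → ℕ) (hr : ∀ n ∈ Y, 1 ≤ r n)
    (hmain : ∀ n ∈ Y, ∀ m : ℕ, m = 0 ∨ m ∈ Y → m < n →
      2 ^ (3 * n + 4) * (∏ i ∈ Finset.range n, if i ∈ Y then r i ^ 32 else 1) < r n ∧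
        r n < 2 ^ 2 ^ (n - m - 3)) :
    ∃ e : ℕ → ℕ,
      (∀ n ∈ Y, 1 ≤ e n ∧ e n ≤ n - 1) ∧
      (∀ n ∈ Y, ∀ m ∈ Y, n ≠ m →
        Disjoint (Set.Icc (n - e n - 1) (n - 1)) (Set.Icc (m - e m - 1) (m - 1))) ∧
      ∀ n ∈ Y,
        r n * 2 ^ (3 * n + 4) *
          (∏ k ∈ Finset.range n, if k ∈ Y then 2 ^ 2 ^ (e k + 2) else 1) ≤
        2 ^ 2 ^ (e n - 1) := by
  have hr2 : ∀ n ∈ Y, 2 ≤ r n := by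
    intro n hn
    have hpos : 1 ≤ ∏ i ∈ Finset.range n, if i ∈ Y then r i ^ 32 else 1 := by
      refine Finset.one_le_prod' fun i _ => ?_
      split_ifs with hi
      · exact Nat.one_le_pow _ _ (hr i hi)
      · exact le_rfl
    exact (Nat.mul_le_mul Nat.one_le_two_pow hpos).trans_lt (hmain n hn 0 (.inl rfl) (hY n hn)).1
  have hgap : ∀ n ∈ Y, ∀ m : ℕ, m = 0 ∨ m ∈ Y → m < n →
      Nat.clog 2 (Nat.clog 2 (r n ^ 2)) + 2 ≤ n - m := fun n hn m hm hmn =>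
    clog_clog_add_two_le (hr2 n hn) (hmain n hn m hm hmn).2
  refine ⟨fun n => Nat.clog 2 (Nat.clog 2 (r n ^ 2)) + 1, fun n hn => ?_, ?_, fun n hn => ?_⟩
  · have := hgap n hn 0 (.inl rfl) (hY n hn)
    dsimp only
    omega
  · intro n hn m hm hnm
    rw [Set.disjoint_left]
    rintro x ⟨hx₁, hx₂⟩ ⟨hx₃, hx₄⟩
    dsimp only at hx₁ hx₃
    have := hY n hn
    have := hY m hm
    rcases lt_or_gt_of_ne hnm with h | h
    · have := hgap m hm n (.inr hn) h
      omega
    · have := hgap n hn m (.inr hm) h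
      omega
  · calc r n * 2 ^ (3 * n + 4) * (∏ k ∈ Finset.range n,
          if k ∈ Y then 2 ^ 2 ^ (Nat.clog 2 (Nat.clog 2 (r k ^ 2)) + 1 + 2) else 1)
        ≤ r n * 2 ^ (3 * n + 4) * ∏ k ∈ Finset.range n, if k ∈ Y then r k ^ 32 else 1 := by
          refine Nat.mul_le_mul_left _ (Finset.prod_le_prod' fun k _ => ?_)
          split_ifs with hk
          · exact two_pow_two_pow_clog_clog_le (hr2 k hk)
          · exact le_rfl
      _ ≤ r n * r n := by
          rw [mul_assoc]
          exact Nat.mul_le_mul_left _ (hmain n hn 0 (.inl rfl) (hY n hn)).1.le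
      _ = r n ^ 2 := (sq _).symm
      _ ≤ 2 ^ 2 ^ (Nat.clog 2 (Nat.clog 2 (r n ^ 2)) + 1 - 1) := clog_clog_le_iff.1 le_rfl
end

section
/- The set E is a two-sided ideal of A. Moreover, if V(2^n) ≠ 0 for every n ≥ 0, then the quotient algebra A/E is infinite-dimensional over K. -/
/-
Formalization of statements from:
"Golod-Shafarevich algebras of a reduced number of defining relations" (A. Smoktunowicz).

`FA K` is the free associative unital `K`-algebra `A = K⟨x,y⟩` on two generators
(`FreeAlgebra.ι K 0` and `FreeAlgebra.ι K 1`), graded with the generators in degree 1.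
-/

open scoped Pointwise Classical

noncomputable section

variable (K : Type) [Field K]

section Auxiliary

variable {K}

theorem Adeg_mul_s3 (i j : ℕ) : Adeg K i * Adeg K j = Adeg K (i + j) := by
  rw [Adeg, Adeg, Submodule.span_mul_span, Adeg]
  congr 1
  ext m
  constructor
  · rintro ⟨_, ⟨w, hw, rfl⟩, _, ⟨w', hw', rfl⟩, rfl⟩
    exact ⟨w ++ w', by simp [hw, hw'], by simp⟩
  · rintro ⟨w, hw, rfl⟩
    refine ⟨_, ⟨w.take i, by simp [hw], rfl⟩, _, ⟨w.drop i, by simp [hw], rfl⟩, ?_⟩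
    simp only [← List.prod_append, ← List.map_append, List.take_append_drop]

theorem one_mem_Adeg_zero : (1 : FA K) ∈ Adeg K 0 :=
  Submodule.subset_span ⟨[], rfl, by simp⟩

theorem mul_mem_Adeg {i j : ℕ} {a b : FA K} (ha : a ∈ Adeg K i) (hb : b ∈ Adeg K j) :
    a * b ∈ Adeg K (i + j) :=
  Adeg_mul_s3 (K := K) i j ▸ Submodule.mul_mem_mul ha hb

theorem span_iUnion_Mon : Submodule.span K (⋃ k, Mon K k) = ⊤ := by
  rw [eq_top_iff]
  rintro a -
  induction a using FreeAlgebra.induction with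
  | grade0 r =>
    rw [Algebra.algebraMap_eq_smul_one]
    exact Submodule.smul_mem _ _
      (Submodule.subset_span (Set.mem_iUnion.2 ⟨0, [], rfl, by simp⟩))
  | grade1 x => exact Submodule.subset_span (Set.mem_iUnion.2 ⟨1, [x], rfl, by simp⟩)
  | add a b ha hb => exact Submodule.add_mem _ ha hb
  | mul a b ha hb =>
    have h := Submodule.mul_mem_mul ha hb
    rw [Submodule.span_mul_span] at h
    refine Submodule.span_mono ?_ h
    rintro _ ⟨u, hu, v, hv, rfl⟩
    obtain ⟨i, w, hw, rfl⟩ := Set.mem_iUnion.1 hu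
    obtain ⟨j, w', hw', rfl⟩ := Set.mem_iUnion.1 hv
    exact Set.mem_iUnion.2 ⟨i + j, w ++ w', by simp [hw, hw'], by simp⟩

/-- The algebra map sending a homogeneous element `a` of degree `k` to `a X ^ k`. -/
def gradingHom : FA K →ₐ[K] Polynomial (FA K) :=
  FreeAlgebra.lift K fun i => Polynomial.monomial 1 (FreeAlgebra.ι K i)

theorem gradingHom_of_mem_Adeg {k : ℕ} {a : FA K} (ha : a ∈ Adeg K k) :
    gradingHom a = Polynomial.monomial k a := by
  induction ha using Submodule.span_induction with
  | mem a ha =>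
    obtain ⟨w, rfl, rfl⟩ := ha
    induction w with
    | nil => simp
    | cons x w ih =>
      simp only [List.map_cons, List.prod_cons, map_mul, ih, List.length_cons]
      rw [gradingHom, FreeAlgebra.lift_ι_apply, Polynomial.monomial_mul_monomial, add_comm 1]
  | zero => simp
  | add a b _ _ ha hb => simp [ha, hb]
  | smul c a _ ha => rw [map_smul, ha, Polynomial.smul_monomial]

/-- The projection of the free algebra onto its homogeneous component of degree `d`. -/
def homogProj (d : ℕ) : FA K →ₗ[K] FA K where
  toFun a := (gradingHom a).coeff d
  map_add' := by simp
  map_smul' := by simp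

theorem homogProj_of_mem_Adeg {k d : ℕ} {a : FA K} (ha : a ∈ Adeg K k) :
    homogProj d a = if k = d then a else 0 := by
  change (gradingHom a).coeff d = _
  rw [gradingHom_of_mem_Adeg ha, Polynomial.coeff_monomial]

/-- The subspace `U(2^N) A(2^N) + A(2^N) U(2^N)` of `A(2^(N+1))`. -/
def flank (U : ℕ → Submodule K (FA K)) (N : ℕ) : Submodule K (FA K) :=
  U N * Adeg K (2 ^ N) ⊔ Adeg K (2 ^ N) * U N

theorem mem_ESet_iff {U : ℕ → Submodule K (FA K)} {k : ℕ} {r : FA K} :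
    r ∈ ESet K U k ↔ r ∈ Adeg K k ∧ ∀ i j, i + k + j = 2 ^ (Nat.log 2 k + 2) →
      ∀ a ∈ Adeg K i, ∀ b ∈ Adeg K j, a * r * b ∈ flank U (Nat.log 2 k + 1) := by
  refine and_congr_right fun hr => ⟨fun h i j hij a ha b hb => h ⟨?_, ?_⟩, ?_⟩
  · exact Submodule.mul_mem_mul (Submodule.mul_mem_mul trivial
      (Submodule.mem_span_singleton_self r)) trivial
  · have := mul_mem_Adeg (mul_mem_Adeg ha hr) hb
    rwa [hij] at this
  · rintro h s ⟨hs, hsd⟩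
    have hproj : ∀ t ∈ (⊤ : Submodule K (FA K)) * Submodule.span K {r} * ⊤,
        homogProj (2 ^ (Nat.log 2 k + 2)) t ∈ flank U (Nat.log 2 k + 1) := by
      intro t ht
      rw [← span_iUnion_Mon, Submodule.span_mul_span, Submodule.span_mul_span] at ht
      induction ht using Submodule.span_induction with
      | mem t ht =>
        obtain ⟨_, ⟨a, ha, _, rfl, rfl⟩, b, hb, rfl⟩ := ht
        obtain ⟨i, hi⟩ := Set.mem_iUnion.1 ha
        obtain ⟨j, hj⟩ := Set.mem_iUnion.1 hb
        have hi' : a ∈ Adeg K i := Submodule.subset_span hi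
        have hj' : b ∈ Adeg K j := Submodule.subset_span hj
        change homogProj _ (a * _ * b) ∈ _
        rw [homogProj_of_mem_Adeg (mul_mem_Adeg (mul_mem_Adeg hi' hr) hj')]
        split_ifs with hd
        · exact h i j hd a hi' b hj'
        · exact Submodule.zero_mem _
      | zero => simp
      | add a b _ _ ha hb => rw [map_add]; exact Submodule.add_mem _ ha hb
      | smul c a _ ha => rw [map_smul]; exact Submodule.smul_mem _ c ha
    have := hproj s hs
    rw [homogProj_of_mem_Adeg hsd, if_pos rfl] at this
    exact this

theorem zero_mem_ESet (U : ℕ → Submodule K (FA K)) (k : ℕ) : 0 ∈ ESet K U k :=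
  mem_ESet_iff.2 ⟨Submodule.zero_mem _, by simp⟩

theorem add_mem_ESet {U : ℕ → Submodule K (FA K)} {k : ℕ} {r s : FA K}
    (hr : r ∈ ESet K U k) (hs : s ∈ ESet K U k) : r + s ∈ ESet K U k := by
  rw [mem_ESet_iff] at *
  refine ⟨Submodule.add_mem _ hr.1 hs.1, fun i j hij a ha b hb => ?_⟩
  rw [mul_add, add_mul]
  exact Submodule.add_mem _ (hr.2 i j hij a ha b hb) (hs.2 i j hij a ha b hb)

theorem smul_mem_ESet {U : ℕ → Submodule K (FA K)} {k : ℕ} {r : FA K} (c : K)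
    (hr : r ∈ ESet K U k) : c • r ∈ ESet K U k := by
  rw [mem_ESet_iff] at *
  refine ⟨Submodule.smul_mem _ c hr.1, fun i j hij a ha b hb => ?_⟩
  rw [mul_smul_comm, smul_mul_assoc]
  exact Submodule.smul_mem _ c (hr.2 i j hij a ha b hb)

theorem ESet_subset_Esub {U : ℕ → Submodule K (FA K)} {k : ℕ} (hk : 1 ≤ k) :
    ESet K U k ⊆ Esub K U :=
  fun _ hr => Submodule.subset_span (Set.mem_biUnion (Set.mem_Ici.2 hk) hr)

theorem homogProj_mem_ESet {U : ℕ → Submodule K (FA K)} {a : FA K} (ha : a ∈ Esub K U)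
    (d : ℕ) : homogProj d a ∈ ESet K U d := by
  induction ha using Submodule.span_induction with
  | mem a ha =>
    obtain ⟨k, -, hk⟩ := Set.mem_iUnion₂.1 ha
    rw [homogProj_of_mem_Adeg hk.1]
    split_ifs with h
    · exact h ▸ hk
    · exact zero_mem_ESet U d
  | zero => simpa using zero_mem_ESet U d
  | add a b _ _ ha hb => rw [map_add]; exact add_mem_ESet ha hb
  | smul c a _ ha => rw [map_smul]; exact smul_mem_ESet c ha

variable {U V : ℕ → Submodule K (FA K)}

theorem UVCond.flank_le (h : UVCond K U V) (N : ℕ) : flank U N ≤ U (N + 1) := by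
  obtain ⟨-, -, -, -, h5, -⟩ := h.2.2 (N + 1) (by omega)
  rw [Nat.add_sub_cancel] at h5
  rwa [flank, sup_comm]

theorem UVCond.le_Adeg (h : UVCond K U V) (N : ℕ) : V (N + 1) ≤ Adeg K (2 ^ (N + 1)) := by
  obtain ⟨-, -, h3, -⟩ := h.2.2 (N + 1) (by omega)
  exact h3 ▸ le_sup_left

/-- If all products of total degree `2^(N+1)` around a subspace `T` of degree `k < 2^N` lie in
`U(2^N) A(2^N) + A(2^N) U(2^N)`, the same holds one level up. -/
theorem UVCond.flank_succ (h : UVCond K U V) {T : Submodule K (FA K)} {k N : ℕ} (hk : k < 2 ^ N)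
    (hT : ∀ i j, i + k + j = 2 ^ (N + 1) → Adeg K i * T * Adeg K j ≤ flank U N)
    (i j : ℕ) (hij : i + k + j = 2 ^ (N + 2)) :
    Adeg K i * T * Adeg K j ≤ flank U (N + 1) := by
  have hpow : 2 ^ (N + 2) = 2 ^ (N + 1) + 2 ^ (N + 1) := by ring
  have hpow' : 2 ^ (N + 1) = 2 ^ N + 2 ^ N := by ring
  have hU := h.flank_le N
  have hl : Adeg K (2 ^ N) * U N ≤ U (N + 1) := le_sup_right.trans hU
  have hr : U N * Adeg K (2 ^ N) ≤ U (N + 1) := le_sup_left.trans hU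
  rcases le_or_gt (i + k) (2 ^ (N + 1)) with h1 | h1
  · obtain ⟨j', hj'⟩ := Nat.exists_eq_add_of_le h1
    obtain rfl : j = j' + 2 ^ (N + 1) := by omega
    rw [← Adeg_mul_s3, ← mul_assoc]
    exact (mul_le_mul_left ((hT i j' hj'.symm).trans hU) _).trans le_sup_left
  rcases le_or_gt (2 ^ (N + 1)) i with h2 | h2
  · obtain ⟨i', rfl⟩ := Nat.exists_eq_add_of_le h2
    rw [← Adeg_mul_s3, mul_assoc, mul_assoc, ← mul_assoc (Adeg K i')]
    exact (mul_le_mul_right ((hT i' j (by omega)).trans hU) _).trans le_sup_right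
  · obtain ⟨i', rfl⟩ : ∃ i', i = 2 ^ N + i' := Nat.exists_eq_add_of_le (by omega)
    obtain ⟨j', rfl⟩ : ∃ j', j = j' + 2 ^ N := ⟨j - 2 ^ N, by omega⟩
    calc Adeg K (2 ^ N + i') * T * Adeg K (j' + 2 ^ N)
        = Adeg K (2 ^ N) * (Adeg K i' * T * Adeg K j') * Adeg K (2 ^ N) := by
          rw [← Adeg_mul_s3, ← Adeg_mul_s3]; simp only [mul_assoc]
      _ ≤ Adeg K (2 ^ N) * flank U N * Adeg K (2 ^ N) :=
          mul_le_mul_left (mul_le_mul_right (hT i' j' (by omega)) _) _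
      _ = (Adeg K (2 ^ N) * U N) * Adeg K (2 ^ (N + 1)) ⊔
            Adeg K (2 ^ (N + 1)) * (U N * Adeg K (2 ^ N)) := by
          rw [flank, Submodule.mul_sup, Submodule.sup_mul, hpow', ← Adeg_mul_s3]
          simp only [mul_assoc]
      _ ≤ flank U (N + 1) := sup_le_sup (mul_le_mul_left hl _) (mul_le_mul_right hr _)

theorem UVCond.mul_mul_mem_flank (h : UVCond K U V) {k : ℕ} {r : FA K} (hr : r ∈ ESet K U k)
    {N : ℕ} (hN : Nat.log 2 k + 1 ≤ N) {i j : ℕ} (hij : i + k + j = 2 ^ (N + 1)) {a b : FA K}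
    (ha : a ∈ Adeg K i) (hb : b ∈ Adeg K j) : a * r * b ∈ flank U N := by
  suffices ∀ i j, i + k + j = 2 ^ (N + 1) →
      Adeg K i * Submodule.span K {r} * Adeg K j ≤ flank U N from
    this i j hij (Submodule.mul_mem_mul (Submodule.mul_mem_mul ha
      (Submodule.mem_span_singleton_self r)) hb)
  clear hij
  induction N, hN using Nat.le_induction with
  | base =>
    intro i j hij
    rw [mem_ESet_iff] at hr
    rw [Adeg, Adeg, Submodule.span_mul_span, Submodule.span_mul_span, Submodule.span_le]
    rintro _ ⟨_, ⟨a, ha, _, rfl, rfl⟩, b, hb, rfl⟩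
    exact hr.2 i j hij a (Submodule.subset_span ha) b (Submodule.subset_span hb)
  | succ N hN ih =>
    exact h.flank_succ ((Nat.lt_pow_succ_log_self one_lt_two k).trans_le
      (Nat.pow_le_pow_right two_pos hN)) ih

theorem UVCond.mul_mem_ESet (h : UVCond K U V) {k l : ℕ} {r b : FA K} (hr : r ∈ ESet K U k)
    (hb : b ∈ Adeg K l) : r * b ∈ ESet K U (k + l) := by
  refine mem_ESet_iff.2 ⟨mul_mem_Adeg hr.1 hb, fun i j hij u hu v hv => ?_⟩
  rw [← mul_assoc u, mul_assoc _ b]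
  exact h.mul_mul_mem_flank hr (Nat.succ_le_succ (Nat.log_mono_right (Nat.le_add_right k l)))
    (show _ = 2 ^ (Nat.log 2 (k + l) + 2) by omega) hu (mul_mem_Adeg hb hv)

theorem UVCond.mul_mem_ESet' (h : UVCond K U V) {k l : ℕ} {r b : FA K} (hr : r ∈ ESet K U k)
    (hb : b ∈ Adeg K l) : b * r ∈ ESet K U (l + k) := by
  refine mem_ESet_iff.2 ⟨mul_mem_Adeg hb hr.1, fun i j hij u hu v hv => ?_⟩
  rw [← mul_assoc u]
  exact h.mul_mul_mem_flank hr (Nat.succ_le_succ (Nat.log_mono_right (Nat.le_add_left k l)))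
    (show _ = 2 ^ (Nat.log 2 (l + k) + 2) by omega) (mul_mem_Adeg hu hb) hv

theorem UVCond.mul_mem_Esub (h : UVCond K U V) {a : FA K} (ha : a ∈ Esub K U) (b : FA K) :
    a * b ∈ Esub K U ∧ b * a ∈ Esub K U := by
  have hb : b ∈ Submodule.span K (⋃ k, Mon K k) := span_iUnion_Mon (K := K) ▸ trivial
  have hE : Esub K U * Submodule.span K (⋃ k, Mon K k) ≤ Esub K U := by
    rw [Esub, Submodule.span_mul_span, Submodule.span_le]
    rintro _ ⟨r, hr, m, hm, rfl⟩
    obtain ⟨k, hk, hr⟩ := Set.mem_iUnion₂.1 hr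
    obtain ⟨l, hm⟩ := Set.mem_iUnion.1 hm
    exact ESet_subset_Esub (le_add_right (Set.mem_Ici.1 hk))
      (h.mul_mem_ESet hr (Submodule.subset_span hm))
  have hE' : Submodule.span K (⋃ k, Mon K k) * Esub K U ≤ Esub K U := by
    rw [Esub, Submodule.span_mul_span, Submodule.span_le]
    rintro _ ⟨m, hm, r, hr, rfl⟩
    obtain ⟨k, hk, hr⟩ := Set.mem_iUnion₂.1 hr
    obtain ⟨l, hm⟩ := Set.mem_iUnion.1 hm
    exact ESet_subset_Esub (le_add_left (Set.mem_Ici.1 hk))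
      (h.mul_mem_ESet' hr (Submodule.subset_span hm))
  exact ⟨hE (Submodule.mul_mem_mul ha hb), hE' (Submodule.mul_mem_mul hb ha)⟩

theorem UVCond.exists_notMem_ESet (h : UVCond K U V) (n : ℕ) (hV : V (n + 2) ≠ ⊥) :
    ∃ w ∈ Adeg K (2 ^ n), w ∉ ESet K U (2 ^ n) := by
  by_contra! hall
  refine hV (le_bot_iff.1 ?_)
  obtain ⟨-, -, -, hdisj, -⟩ := h.2.2 (n + 2) (by omega)
  rw [← hdisj]
  refine le_inf le_rfl ((h.le_Adeg (n + 1)).trans (le_trans ?_ (h.flank_le (n + 1))))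
  have hpow : 2 ^ (n + 2) = 2 ^ n + 3 * 2 ^ n := by ring
  rw [show n + 1 + 1 = n + 2 from rfl, hpow, ← Adeg_mul_s3, Submodule.mul_le]
  intro r hr b hb
  rw [← one_mul r]
  refine h.mul_mul_mem_flank (hall r hr) ?_ ?_ one_mem_Adeg_zero hb
  · rw [Nat.log_pow one_lt_two]
  · rw [zero_add, ← hpow]

theorem UVCond.not_finite_quotient (h : UVCond K U V) (hV : ∀ n, V n ≠ ⊥) :
    ¬ Module.Finite K (FA K ⧸ Esub K U) := by
  intro hfin
  choose w hw hwE using fun n => h.exists_notMem_ESet n (hV (n + 2))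
  have hli : LinearIndependent K fun n => (Esub K U).mkQ (w n) := by
    rw [linearIndependent_iff']
    intro s c hs m hm
    simp only [← map_smul, ← map_sum] at hs
    rw [Submodule.mkQ_apply, Submodule.Quotient.mk_eq_zero] at hs
    have hmem := homogProj_mem_ESet hs (2 ^ m)
    have hinj : ∀ n, 2 ^ n = 2 ^ m ↔ n = m := fun n => Nat.pow_right_inj one_lt_two
    simp only [map_sum, map_smul, homogProj_of_mem_Adeg (hw _), hinj, smul_ite, smul_zero,
      Finset.sum_ite_eq', hm, if_true] at hmem
    by_contra hc
    exact hwE m (by simpa [smul_smul, hc] using smul_mem_ESet (c m)⁻¹ hmem)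
  have := hli.finite
  exact not_finite ℕ

end Auxiliary

/-- **Lemma 1.1.**  `E` is a two-sided ideal of `A`; and if all the `V(2^n)` are nonzero
then `A/E` is infinite-dimensional over `K`. -/
theorem statement3 (U V : ℕ → Submodule K (FA K)) (hUV : UVCond K U V) :
    (∀ a ∈ Esub K U, ∀ b : FA K, a * b ∈ Esub K U ∧ b * a ∈ Esub K U) ∧
    ((∀ n : ℕ, V n ≠ ⊥) → ¬ Module.Finite K (FA K ⧸ Esub K U)) := by
  exact ⟨fun _ ha b => hUV.mul_mem_Esub ha b, hUV.not_finite_quotient⟩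

end
end

section
/- Suppose there is an integer α ≥ 1 such that dim_K V(2^m) = 1 for all m ≥ α. Then for every m ≥ α one has V(2^{m+1}) = V(2^m)V(2^m) and U(2^{m+1}) = U(2^m)A(2^m) + A(2^m)U(2^m). -/
/-
Formalization of statements from:
"Golod-Shafarevich algebras of a reduced number of defining relations" (A. Smoktunowicz).

`FA K` is the free associative unital `K`-algebra `A = K⟨x,y⟩` on two generators
(`FreeAlgebra.ι K 0` and `FreeAlgebra.ι K 1`), graded with the generators in degree 1.
-/

open scoped Pointwise Classical

noncomputable section

variable (K : Type) [Field K]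

theorem Mon_add_subset (j k : ℕ) : Mon K (j + k) ⊆ Mon K j * Mon K k := by
  rintro _ ⟨w, hw, rfl⟩
  refine Set.mem_mul.2 ⟨((w.take j).map (FreeAlgebra.ι K)).prod, ⟨w.take j, by simp [hw], rfl⟩,
    ((w.drop j).map (FreeAlgebra.ι K)).prod, ⟨w.drop j, by simp [hw], rfl⟩, ?_⟩
  rw [← List.prod_append, ← List.map_append, List.take_append_drop]

theorem Adeg_add_le (j k : ℕ) : Adeg K (j + k) ≤ Adeg K j * Adeg K k := by
  rw [Adeg, Adeg, Adeg, Submodule.span_mul_span]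
  exact Submodule.span_mono (Mon_add_subset K j k)

/-- A line contained in the product of a line with itself is equal to that product. -/
theorem Submodule.eq_mul_self_of_le_of_finrank_eq_one {F R : Type*} [Field F] [Ring R]
    [Algebra F R] {P Q : Submodule F R} (hP : Module.finrank F P = 1)
    (hQ : Module.finrank F Q = 1) (hle : P ≤ Q * Q) : P = Q * Q := by
  obtain ⟨⟨v, hvQ⟩, -, hv⟩ := finrank_eq_one_iff'.1 hQ
  have hspan : Q = Submodule.span F {v} := by
    refine le_antisymm (fun w hw => ?_) ((Submodule.span_singleton_le_iff_mem _ _).2 hvQ)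
    obtain ⟨c, hc⟩ := hv ⟨w, hw⟩
    exact Submodule.mem_span_singleton.2 ⟨c, congrArg Subtype.val hc⟩
  have hmul : Q * Q = Submodule.span F {v * v} := by
    rw [hspan, Submodule.span_mul_span, Set.singleton_mul_singleton]
  rw [hmul] at hle ⊢
  refine Submodule.eq_of_le_of_finrank_le hle ?_
  rw [hP]
  exact (finrank_span_le_card _).trans (by simp)

/-- **Theorem 1.3.**  If `dim V(2^m) = 1` for all `m ≥ α`, then for all `m ≥ α`,
`V(2^{m+1}) = V(2^m)V(2^m)` and `U(2^{m+1}) = U(2^m)A(2^m) + A(2^m)U(2^m)`. -/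
theorem statement5 (U V : ℕ → Submodule K (FA K)) (hUV : UVCond K U V)
    (α : ℕ) (hα : 1 ≤ α) (hdim : ∀ m, α ≤ m → Module.finrank K (V m) = 1) :
    ∀ m, α ≤ m →
      V (m + 1) = V m * V m ∧
      U (m + 1) = U m * Adeg K (2 ^ m) ⊔ Adeg K (2 ^ m) * U m := by
  intro m hm
  obtain ⟨-, hUA, hsup, hinf, hU, hV⟩ := hUV.2.2 (m + 1) (by omega)
  obtain ⟨-, -, hsup', -⟩ := hUV.2.2 m (hα.trans hm)
  rw [Nat.add_sub_cancel] at hU hV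
  have hVV : V (m + 1) = V m * V m :=
    Submodule.eq_mul_self_of_le_of_finrank_eq_one (hdim _ (by omega)) (hdim m hm) hV
  refine ⟨hVV, (eq_of_le_of_inf_le_of_le_sup (z := V (m + 1)) ?_ ?_ ?_).symm⟩
  · rwa [sup_comm]
  · rw [inf_comm, hinf]
    exact bot_le
  · have hAA : Adeg K (2 ^ (m + 1)) ≤ Adeg K (2 ^ m) * Adeg K (2 ^ m) := by
      rw [pow_succ, mul_two]
      exact Adeg_add_le K _ _
    have hVA : V m ≤ Adeg K (2 ^ m) := hsup' ▸ le_sup_left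
    calc
      U (m + 1) ≤ Adeg K (2 ^ m) * Adeg K (2 ^ m) := hUA.trans hAA
      _ = Adeg K (2 ^ m) * U m ⊔ (V m * V m ⊔ U m * V m) := by
        conv_lhs => rw [← hsup', Submodule.mul_sup, hsup', sup_comm]
        conv_lhs => rw [← hsup', Submodule.sup_mul (V m) (U m) (V m), hsup']
      _ ≤ U m * Adeg K (2 ^ m) ⊔ Adeg K (2 ^ m) * U m ⊔ V (m + 1) := by
        rw [hVV]
        exact sup_le (le_sup_right.trans le_sup_left) (sup_le le_sup_right
          ((mul_le_mul' le_rfl hVA).trans (le_sup_left.trans le_sup_left)))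

end
end
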